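/- Assume all the measures dv_g and ν_a (a a cap) are simple, and let s : [−1,1)×S^n → S^n be the continuous lift of the maximal direction map (r,p) ↦ [s(a_{r,p})] ∈ RP^n with s(−1,·) = −e₁. Then s(a*) = −R_a s(a) for every cap a, where R_a = d_{ξ(a*)} ∘ τ_a ∘ d_{−ξ(a)}. -/

import Mathlib

open MeasureTheory Metric Real Filter Set
open scoped RealInnerProductSpace ENNReal NNReal Topology Classical

noncomputable section

/-- Ambient Euclidean space `ℝ^{n+1}`. -/
abbrev Eu (n : ℕ) : Type := EuclideanSpace ℝ (Fin (n + 1))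

/-- The unit sphere `S^n ⊆ ℝ^{n+1}` as a subset of the ambient space. -/
def sphSet (n : ℕ) : Set (Eu n) := Metric.sphere (0 : Eu n) 1

/-- The canonical (round) volume measure of `S^n`, viewed as a measure on the
ambient space `ℝ^{n+1}` supported on the unit sphere. -/
def sphMeasure (n : ℕ) : Measure (Eu n) :=
  Measure.map Subtype.val ((volume : Measure (Eu n)).toSphere)

/-- `σ_n`, the volume of the round unit `n`-sphere. -/
def sigmaVol (n : ℕ) : ℝ := (sphMeasure n Set.univ).toReal

/-- The constant `K_n`. -/
def Kconst (n : ℕ) : ℝ :=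
  ((n + 1 : ℝ) / n) *
    ((Real.Gamma n * Real.Gamma ((n + 1) / 2)) /
      (Real.Gamma (n + 1 / 2) * Real.Gamma (n / 2))) ^ ((2 : ℝ) / n)

/-- The linear coordinate function `X_s(x) = s · x`. -/
def Xfun {n : ℕ} (s x : Eu n) : ℝ := ⟪s, x⟫

/-- The tangential gradient on the sphere of (the restriction of) an ambient function:
`∇_{S^n} f (x) = ∇f(x) - ⟨∇f(x), x⟩ x`. -/
def gradS {n : ℕ} (f : Eu n → ℝ) (x : Eu n) : Eu n :=
  gradient f x - ⟪gradient f x, x⟫ • x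

/-- A conformal factor `w` represents the metric `g = w² g₀` on `S^n`; it is admissible if it
is smooth and positive on the sphere. -/
def IsConformalFactor (n : ℕ) (w : Eu n → ℝ) : Prop :=
  ContDiff ℝ (⊤ : ℕ∞) w ∧ ∀ x ∈ sphSet n, 0 < w x

/-- The Riemannian measure `dv_g` of the conformal metric `g = w² g₀`, i.e. `w^n dv_{g₀}`. -/
def confMeasure (n : ℕ) (w : Eu n → ℝ) : Measure (Eu n) :=
  (sphMeasure n).withDensity fun x => ENNReal.ofReal (w x ^ n)

/-- The volume of `(S^n, g)`, `g = w² g₀`. -/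
def confVol (n : ℕ) (w : Eu n → ℝ) : ℝ := (confMeasure n w Set.univ).toReal

/-- The Dirichlet energy `∫ |∇_g u|²_g dv_g` of the restriction to `S^n` of `V`,
for `g = w² g₀`: it equals `∫ w^{n-2} |∇_{g₀} V|²_{g₀} dv_{g₀}`. -/
def dirichlet (n : ℕ) (w : Eu n → ℝ) (V : Eu n → ℝ) : ℝ :=
  ∫ x, w x ^ (n - 2) * ‖gradS V x‖ ^ 2 ∂(sphMeasure n)

/-- `∫ u² dv_g`. -/
def l2sq (n : ℕ) (w : Eu n → ℝ) (V : Eu n → ℝ) : ℝ :=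
  ∫ x, (V x) ^ 2 ∂(confMeasure n w)

/-- Mean value zero w.r.t. `dv_g`. -/
def MeanZero (n : ℕ) (w : Eu n → ℝ) (V : Eu n → ℝ) : Prop :=
  ∫ x, V x ∂(confMeasure n w) = 0

/-- The second nonzero eigenvalue `λ₂(S^n, g)` of the Laplace–Beltrami operator of
`g = w² g₀`, defined via the Courant–Fischer min-max characterization over two-dimensional
spaces of mean-zero test functions (restrictions of smooth ambient functions). -/
def lambda2 (n : ℕ) (w : Eu n → ℝ) : ℝ :=
  sInf { Λ : ℝ | ∃ V W : Eu n → ℝ, ContDiff ℝ (⊤ : ℕ∞) V ∧ ContDiff ℝ (⊤ : ℕ∞) W ∧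
    MeanZero n w V ∧ MeanZero n w W ∧
    (∀ a b : ℝ, (∀ x ∈ sphSet n, a * V x + b * W x = 0) → a = 0 ∧ b = 0) ∧
    Λ = sSup { q : ℝ | ∃ a b : ℝ, ¬(a = 0 ∧ b = 0) ∧
      q = dirichlet n w (fun x => a * V x + b * W x) /
          l2sq n w (fun x => a * V x + b * W x) } }

/-- The conformal transformation `d_ξ` of the closed unit ball. -/
def dMap {n : ℕ} (ξ : Eu n) (x : Eu n) : Eu n :=
  (1 + 2 * ⟪ξ, x⟫ + ‖x‖ ^ 2 * ‖ξ‖ ^ 2)⁻¹ •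
    ((1 - ‖ξ‖ ^ 2) • x + (1 + 2 * ⟪ξ, x⟫ + ‖x‖ ^ 2) • ξ)

/-- The reflection `R_p(x) = x - 2(p·x)p`. -/
def Refl {n : ℕ} (p x : Eu n) : Eu n := x - (2 * ⟪p, x⟫) • p

/-- The spherical cap `a_{r,p} = d_{rp}(a_{0,p})`. -/
def cap (n : ℕ) (r : ℝ) (p : Eu n) : Set (Eu n) :=
  dMap (r • p) '' {x ∈ sphSet n | 0 < ⟪p, x⟫}

/-- The conformal reflection `τ_{a_{r,p}} = d_{rp} ∘ R_p ∘ d_{-rp}`. -/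
def tauMap {n : ℕ} (r : ℝ) (p : Eu n) : Eu n → Eu n :=
  dMap (r • p) ∘ Refl p ∘ dMap (-(r • p))

/-- The measure `μ_{a_{r,p}}`, equal to `dv_g + (τ_a)^* dv_g` on `a` and `0` on `a^*`. -/
def capMeasure (n : ℕ) (w : Eu n → ℝ) (r : ℝ) (p : Eu n) : Measure (Eu n) :=
  (confMeasure n w + Measure.map (tauMap r p) (confMeasure n w)).restrict (cap n r p)

/-- `d_ξ` renormalizes the finite measure `μ`: `∫ X_s ∘ d_ξ dμ = 0` for all `s ∈ S^n`. -/
def Renormalizes {n : ℕ} (ξ : Eu n) (μ : Measure (Eu n)) : Prop :=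
  ∀ s ∈ sphSet n, ∫ x, Xfun s (dMap ξ x) ∂μ = 0

/-- The quadratic form `Q(s) = ∫ X_s² dν` of a measure `ν`. -/
def Qform {n : ℕ} (ν : Measure (Eu n)) (s : Eu n) : ℝ := ∫ x, (⟪s, x⟫ : ℝ) ^ 2 ∂ν

/-- The maximal eigenvalue of the quadratic form `Q`. -/
def maxEig (n : ℕ) (ν : Measure (Eu n)) : ℝ :=
  sSup { q : ℝ | ∃ s : Eu n, ‖s‖ = 1 ∧ q = Qform ν s }

/-- `ν` is simple with (unit) maximal direction `s₀`: the eigenspace of the maximal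
eigenvalue of `Q` is the line spanned by `s₀`. -/
def IsMaxDir {n : ℕ} (ν : Measure (Eu n)) (s₀ : Eu n) : Prop :=
  ‖s₀‖ = 1 ∧ ∀ s : Eu n, Qform ν s = maxEig n ν * ‖s‖ ^ 2 ↔ ∃ c : ℝ, s = c • s₀

/-- `ν` is multiple: the eigenspace of the maximal eigenvalue of `Q` has dimension ≥ 2. -/
def IsMultiple {n : ℕ} (ν : Measure (Eu n)) : Prop :=
  ∃ s t : Eu n, Qform ν s = maxEig n ν * ‖s‖ ^ 2 ∧ Qform ν t = maxEig n ν * ‖t‖ ^ 2 ∧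
    LinearIndependent ℝ ![s, t]

/-- The test function `u_a^s` (for `a = a_{r,p}` with renormalization point `ξ`):
`X_s ∘ d_ξ` on `a` and `X_s ∘ d_ξ ∘ τ_a` on `a^*`. -/
def testFun (n : ℕ) (ξ : Eu n) (r : ℝ) (p : Eu n) (s : Eu n) (x : Eu n) : ℝ :=
  if 0 < ⟪p, dMap (-(r • p)) x⟫ then Xfun s (dMap ξ x) else Xfun s (dMap ξ (tauMap r p x))

/-- The first coordinate vector `e₁ ∈ ℝ^{n+1}`. -/
def e1 (n : ℕ) : Eu n := EuclideanSpace.single 0 1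

/-! ### A parity lemma of Sperner type on the Freudenthal triangulation of a cube -/

/-- The `k`-th vertex of the simplex with base point `b` of the Freudenthal triangulation in which
the coordinate `i` is incremented at step `w i`. -/
def kuhnVertex {N : ℕ} (b : Fin N → ℕ) (w : Equiv.Perm (Fin N)) (k : ℕ) (i : Fin N) : ℕ :=
  b i + if (w i : ℕ) < k then 1 else 0

/-- Indicator modulo two of the simplices on which a labelling is injective. -/
def rainbow {N : ℕ} (lab : (Fin N → ℕ) → Fin (N + 1)) (b : Fin N → ℕ)
    (w : Equiv.Perm (Fin N)) : ZMod 2 :=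
  if Function.Injective (fun k : Fin (N + 1) => lab (kuhnVertex b w k)) then 1 else 0

/-- Indicator modulo two of the injective families of labels which avoid the label `0`. -/
def door {N : ℕ} (μ : Fin N → Fin (N + 1)) : ZMod 2 :=
  if Function.Injective μ ∧ ∀ k, μ k ≠ 0 then 1 else 0

lemma door_comp_succAbove {N : ℕ} (μ : Fin (N + 1) → Fin (N + 1)) (k : Fin (N + 1)) :
    door (fun m => μ (k.succAbove m)) =
      if InjOn μ {k}ᶜ ∧ ∀ l, l ≠ k → μ l ≠ 0 then 1 else 0 := by
  unfold door
  congr 1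
  apply propext
  refine and_congr ⟨fun h x hx y hy hxy => ?_, fun h x y hxy => ?_⟩
    ⟨fun h l hl => ?_, fun h l => h _ (Fin.succAbove_ne k l)⟩
  · obtain ⟨a, rfl⟩ := Fin.exists_succAbove_eq (show x ≠ k from hx)
    obtain ⟨c, rfl⟩ := Fin.exists_succAbove_eq (show y ≠ k from hy)
    rw [h hxy]
  · exact Fin.succAbove_right_injective (h (Fin.succAbove_ne k x) (Fin.succAbove_ne k y) hxy)
  · obtain ⟨a, rfl⟩ := Fin.exists_succAbove_eq hl
    exact h a

lemma sum_door_succAbove {N : ℕ} (μ : Fin (N + 1) → Fin (N + 1)) :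
    ∑ k : Fin (N + 1), door (fun m => μ (k.succAbove m)) =
      if Function.Injective μ then 1 else 0 := by
  simp_rw [door_comp_succAbove]
  by_cases hμ : Function.Injective μ
  · rw [if_pos hμ]
    obtain ⟨k₀, hk₀⟩ := (Finite.injective_iff_surjective.1 hμ) 0
    rw [Finset.sum_eq_single k₀]
    · rw [if_pos ⟨hμ.injOn, fun l hl h => hl (hμ (h.trans hk₀.symm))⟩]
    · intro k _ hk
      rw [if_neg]
      rintro ⟨-, h⟩
      exact h k₀ hk.symm hk₀
    · simp
  · rw [if_neg hμ]
    by_cases hex : ∃ k, InjOn μ {k}ᶜ ∧ ∀ l, l ≠ k → μ l ≠ 0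
    · obtain ⟨k, hk, hk0⟩ := hex
      obtain ⟨k', hk', hkk⟩ : ∃ k', k' ≠ k ∧ μ k' = μ k := by
        by_contra! hcon
        apply hμ
        intro x y hxy
        by_cases hx : x = k
        · subst hx
          by_contra hne
          exact hcon y (Ne.symm hne) hxy.symm
        · by_cases hy : y = k
          · subst hy
            exact absurd hxy (hcon x hx)
          · exact hk hx hy hxy
      have hgood : InjOn μ {k'}ᶜ ∧ ∀ l, l ≠ k' → μ l ≠ 0 := by
        have key : ∀ m, m ≠ k' → μ m = μ k → m = k := by
          intro m hm h
          by_contra hmk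
          exact hm (hk hmk hk' (h.trans hkk.symm))
        refine ⟨fun x hx y hy hxy => ?_, fun l hl => ?_⟩
        · by_cases hxk : x = k
          · subst hxk
            exact (key y hy hxy.symm).symm
          · by_cases hyk : y = k
            · subst hyk
              exact key x hx hxy
            · exact hk hxk hyk hxy
        · by_cases hlk : l = k
          · subst hlk
            rw [← hkk]
            exact hk0 k' hk'
          · exact hk0 l hlk
      rw [← Finset.sum_subset (Finset.subset_univ {k, k'}), Finset.sum_pair hk'.symm,
        if_pos ⟨hk, hk0⟩, if_pos hgood]
      · exact CharTwo.add_self_eq_zero 1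
      · intro l _ hl
        simp only [Finset.mem_insert, Finset.mem_singleton, not_or] at hl
        rw [if_neg]
        rintro ⟨h, -⟩
        exact hk' (h (Ne.symm hl.2) (Ne.symm hl.1) hkk)
    · push Not at hex
      refine Finset.sum_eq_zero fun k _ => if_neg ?_
      rintro ⟨h1, h2⟩
      obtain ⟨l, hl, h⟩ := hex k h1
      exact h2 l hl h

lemma sum_interior_facet {N : ℕ} (lab : (Fin (N + 1) → ℕ) → Fin (N + 2)) (b : Fin (N + 1) → ℕ)
    (k : Fin N) :
    ∑ w : Equiv.Perm (Fin (N + 1)),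
      door (fun m => lab (kuhnVertex b w (k.succ.castSucc.succAbove m))) = 0 := by
  have hne : k.castSucc ≠ k.succ := (Fin.castSucc_lt_succ).ne
  refine Finset.sum_involution (fun w _ => Equiv.swap k.castSucc k.succ * w) ?_ ?_ ?_ ?_
  · intro w _
    have : ∀ m : Fin (N + 1),
        kuhnVertex b (Equiv.swap k.castSucc k.succ * w) (k.succ.castSucc.succAbove m) =
          kuhnVertex b w (k.succ.castSucc.succAbove m) := by
      intro m
      have hm : ((k.succ.castSucc.succAbove m : Fin (N + 2)) : ℕ) ≠ (k : ℕ) + 1 := by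
        intro h
        exact Fin.succAbove_ne k.succ.castSucc m (Fin.ext (by simpa using h))
      funext i
      unfold kuhnVertex
      congr 1
      rw [Equiv.Perm.mul_apply, Equiv.swap_apply_def]
      split_ifs with h1 h2 h3 h4 h5 h6 <;> simp_all <;> omega
    simp_rw [this]
    exact CharTwo.add_self_eq_zero _
  · intro w _ _ h
    have := mul_right_cancel (h.trans (one_mul w).symm)
    exact hne (Equiv.swap_eq_one_iff.1 this)
  · intros; simp
  · intro w _
    simp [← mul_assoc]

lemma kuhnVertex_succ {N : ℕ} (b : Fin (N + 1) → ℕ) (w : Equiv.Perm (Fin (N + 1)))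
    (m : Fin (N + 1)) :
    kuhnVertex b w (m + 1) =
      kuhnVertex (Function.update b (w.symm 0) (b (w.symm 0) + 1))
        ((finRotate (N + 1)).symm * w) m := by
  funext i
  unfold kuhnVertex
  rw [Equiv.Perm.mul_apply]
  by_cases hi : w i = 0
  · have : i = w.symm 0 := by rw [← hi]; simp
    subst this
    have h2 : (finRotate (N + 1)).symm 0 = Fin.last N := by
      rw [Equiv.symm_apply_eq, finRotate_last]
    simp [h2]
    omega
  · have h1 : i ≠ w.symm 0 := by
      rintro rfl; simp at hi
    obtain ⟨j, hj⟩ := Fin.exists_succ_eq.2 hi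
    have h2 : (finRotate (N + 1)).symm j.succ = j.castSucc := by
      rw [Equiv.symm_apply_eq]
      simp
    rw [Function.update_of_ne h1, ← hj, h2]
    simp

lemma sum_telescope {N M : ℕ} (c : Fin (N + 1)) (H : (Fin (N + 1) → ℕ) → ZMod 2) :
    ∑ b : Fin (N + 1) → Fin M,
      (H (Function.update (fun i => (b i : ℕ)) c (b c + 1)) + H (fun i => (b i : ℕ))) =
    ∑ y : Fin N → Fin M, (H (c.insertNth M (fun i => (y i : ℕ))) +
      H (c.insertNth 0 (fun i => (y i : ℕ)))) := by
  rw [← (Fin.insertNthEquiv (fun _ => Fin M) c).sum_comp, Fintype.sum_prod_type,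
    Finset.sum_comm]
  refine Finset.sum_congr rfl fun y _ => ?_
  have h1 : ∀ t : Fin M, (fun i => (((Fin.insertNthEquiv (fun _ => Fin M) c) (t, y) i : Fin M) : ℕ))
      = c.insertNth (t : ℕ) (fun i => (y i : ℕ)) := by
    intro t
    funext i
    refine Fin.succAboveCases c ?_ (fun j => ?_) i <;> simp
  have h2 : ∀ t : Fin M, Function.update (fun i =>
      (((Fin.insertNthEquiv (fun _ => Fin M) c) (t, y) i : Fin M) : ℕ)) c
        ((((Fin.insertNthEquiv (fun _ => Fin M) c) (t, y) c : Fin M) : ℕ) + 1)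
      = c.insertNth ((t : ℕ) + 1) (fun i => (y i : ℕ)) := by
    intro t
    rw [h1]
    funext i
    refine Fin.succAboveCases c ?_ (fun j => ?_) i <;> simp
  simp_rw [h2, h1]
  rw [Finset.sum_range (fun t => H (c.insertNth (t + 1) (fun i => (y i : ℕ))) +
    H (c.insertNth t (fun i => (y i : ℕ)))) |>.symm]
  have := Finset.sum_range_sub (fun t => H (c.insertNth t (fun i => (y i : ℕ)))) M
  simpa only [CharTwo.sub_eq_add] using this

lemma door_eq_zero {N : ℕ} (μ : Fin (N + 1) → Fin (N + 2)) (a : Fin (N + 2)) (ha : a ≠ 0)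
    (h : ∀ k, μ k ≠ a) : door μ = 0 := by
  refine if_neg ?_
  rintro ⟨hinj, h0⟩
  have h1 : (Finset.univ.image μ).card = N + 1 := by
    rw [Finset.card_image_of_injective _ hinj]; simp
  have h2 : Finset.univ.image μ ⊆ (Finset.univ.erase 0).erase a := by
    intro x hx
    obtain ⟨k, -, rfl⟩ := Finset.mem_image.1 hx
    simp [h k, h0 k]
  have h3 := Finset.card_le_card h2
  rw [Finset.card_erase_of_mem (by simpa using ha), Finset.card_erase_of_mem (by simp), h1] at h3
  simp at h3

/-- If on every face `x i = 0` the label `i` is not used, and on every face `x i = M` the last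
label is not used, then the number of simplices with all labels is odd. -/
theorem sum_rainbow_eq_one {M N : ℕ} (lab : (Fin N → ℕ) → Fin (N + 1))
    (h0 : ∀ x i, x i = 0 → lab x ≠ i.castSucc) (h1 : ∀ x i, x i = M → lab x ≠ Fin.last N) :
    ∑ b : Fin N → Fin M, ∑ w, rainbow lab (fun i => (b i : ℕ)) w = 1 := by
  induction N with
  | zero =>
    simp [rainbow, Function.injective_of_subsingleton]
  | succ N ih =>
    set H : Equiv.Perm (Fin (N + 1)) → (Fin (N + 1) → ℕ) → ZMod 2 := fun w b =>
      door (fun m : Fin (N + 1) => lab (kuhnVertex b ((finRotate (N + 1)).symm * w) m)) with hH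
    have step1 : ∀ b : Fin (N + 1) → ℕ, ∑ w, rainbow lab b w =
        ∑ w : Equiv.Perm (Fin (N + 1)),
          (H w (Function.update b (w.symm 0) (b (w.symm 0) + 1)) + H w b) := by
      intro b
      have e1 : ∀ w, rainbow lab b w = ∑ k : Fin (N + 2),
          door (fun m => lab (kuhnVertex b w (k.succAbove m))) := fun w =>
        (sum_door_succAbove (fun k : Fin (N + 2) => lab (kuhnVertex b w k))).symm
      simp_rw [e1]
      rw [Finset.sum_comm, Fin.sum_univ_succ, Fin.sum_univ_castSucc]
      have e2 : ∀ k : Fin N, ∑ w : Equiv.Perm (Fin (N + 1)),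
          door (fun m => lab (kuhnVertex b w (k.castSucc.succ.succAbove m))) = 0 := fun k =>
        sum_interior_facet lab b k
      rw [Finset.sum_congr rfl (fun k _ => e2 k), Finset.sum_const_zero, zero_add,
        Finset.sum_add_distrib]
      congr 1
      · refine Finset.sum_congr rfl fun w _ => ?_
        rw [hH]
        simp only [Fin.zero_succAbove, Fin.val_succ, kuhnVertex_succ]
      · rw [← Equiv.sum_comp (Equiv.mulLeft (finRotate (N + 1)).symm)]
        refine Finset.sum_congr rfl fun w _ => ?_
        simp [hH]
    have hc : ∀ (w : Equiv.Perm (Fin (N + 1))) (m : Fin (N + 1)) (x : Fin (N + 1) → ℕ),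
        kuhnVertex x ((finRotate (N + 1)).symm * w) m (w.symm 0) = x (w.symm 0) := by
      intro w m x
      have h2 : (finRotate (N + 1)).symm 0 = Fin.last N := by
        rw [Equiv.symm_apply_eq, finRotate_last]
      simp [kuhnVertex, Equiv.Perm.mul_apply, h2]
      omega
    have hM0 : ∀ w (y : Fin N → ℕ), H w ((w.symm 0).insertNth M y) = 0 := by
      intro w y
      refine door_eq_zero _ (Fin.last _) (Fin.last_pos.ne') fun k => ?_
      exact h1 _ (w.symm 0) (by rw [hc]; simp)
    have h00 : ∀ w (y : Fin N → ℕ), w 0 ≠ 0 → H w ((w.symm 0).insertNth 0 y) = 0 := by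
      intro w y hw
      have hw' : w.symm 0 ≠ 0 := by
        intro h; apply hw; rw [Equiv.symm_apply_eq] at h; exact h.symm
      refine door_eq_zero _ (w.symm 0).castSucc (by simpa using hw') fun k => ?_
      exact h0 _ (w.symm 0) (by rw [hc]; simp)
    have hlast : ∀ (ρ : Equiv.Perm (Fin N)) (y : Fin N → ℕ),
        H (Equiv.Perm.decomposeFin.symm (0, ρ)) (Fin.insertNth 0 0 y) =
          rainbow (fun x => if h : lab (Fin.cons 0 x) = 0 then 0 else
            (lab (Fin.cons 0 x)).pred h) y ρ := by
      intro ρ y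
      have hv : ∀ m : Fin (N + 1), kuhnVertex (Fin.insertNth 0 0 y : Fin (N + 1) → ℕ)
          ((finRotate (N + 1)).symm * Equiv.Perm.decomposeFin.symm (0, ρ)) m =
          Fin.cons 0 (kuhnVertex y ρ m) := by
        intro m
        funext i
        refine Fin.cases ?_ (fun j => ?_) i
        · have h2 : (finRotate (N + 1)).symm 0 = Fin.last N := by
            rw [Equiv.symm_apply_eq, finRotate_last]
          simp [kuhnVertex, Equiv.Perm.mul_apply, h2]
          omega
        · have h2 : (finRotate (N + 1)).symm (ρ j).succ = (ρ j).castSucc := by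
            rw [Equiv.symm_apply_eq]
            simp
          simp [kuhnVertex, Equiv.Perm.mul_apply, h2]
      have hn0 : ∀ x : Fin N → ℕ, lab (Fin.cons 0 x) ≠ 0 := fun x => h0 _ 0 (by simp)
      simp only [hH, door, rainbow, hv, hn0, dif_neg, not_false_eq_true]
      congr 1
      apply propext
      refine ⟨fun h x y' hxy => h.1 (Fin.pred_inj.1 hxy), fun h => ⟨fun x y' hxy => h ?_,
        fun k => hn0 _⟩⟩
      exact Fin.pred_inj.2 hxy
    simp_rw [step1]
    rw [Finset.sum_comm]
    simp_rw [fun w : Equiv.Perm (Fin (N + 1)) => sum_telescope (M := M) (w.symm 0) (H w), hM0,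
      zero_add]
    rw [← Equiv.Perm.decomposeFin.symm.sum_comp, Fintype.sum_prod_type,
      Finset.sum_eq_single (0 : Fin (N + 1))]
    · have hs : ∀ ρ : Equiv.Perm (Fin N),
          (Equiv.Perm.decomposeFin.symm ((0 : Fin (N + 1)), ρ)).symm 0 = 0 := by
        intro ρ
        rw [Equiv.symm_apply_eq]
        simp
      simp_rw [hs, hlast]
      rw [Finset.sum_comm]
      apply ih
      · intro x i hx
        rw [dif_neg (show lab (Fin.cons 0 x) ≠ 0 from h0 _ 0 rfl)]
        intro h
        refine h0 (Fin.cons 0 x) i.succ (by simpa using hx) ?_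
        rw [Fin.pred_eq_iff_eq_succ] at h
        rw [h, Fin.succ_castSucc]
      · intro x i hx
        rw [dif_neg (show lab (Fin.cons 0 x) ≠ 0 from h0 _ 0 rfl)]
        intro h
        refine h1 (Fin.cons 0 x) i.succ (by simpa using hx) ?_
        rw [Fin.pred_eq_iff_eq_succ] at h
        rw [h, Fin.succ_last]
    · intro p _ hp
      refine Finset.sum_eq_zero fun ρ _ => Finset.sum_eq_zero fun y _ => h00 _ _ ?_
      simpa using hp
    · simp

lemma kuhnVertex_reflect {N M : ℕ} (b : Fin N → Fin M) (w : Equiv.Perm (Fin N))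
    (k : Fin (N + 1)) (i : Fin N) :
    kuhnVertex (fun i => ((b i).rev : ℕ)) (w.trans Fin.revPerm) k i +
      kuhnVertex (fun i => (b i : ℕ)) w (k.rev : Fin (N + 1)) i = M := by
  simp only [kuhnVertex, Equiv.trans_apply, Fin.revPerm_apply, Fin.val_rev]
  have := (b i).isLt
  have := (w i).isLt
  have := k.isLt
  split_ifs <;> omega

/-- A labelling satisfying the boundary conditions of `sum_rainbow_eq_one` cannot be symmetric
on all the simplices. -/
theorem exists_rainbow_ne {M : ℕ} (hM2 : Even M) {N : ℕ} (hN : 0 < N)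
    (lab : (Fin N → ℕ) → Fin (N + 1))
    (h0 : ∀ x i, x i = 0 → lab x ≠ i.castSucc) (h1 : ∀ x i, x i = M → lab x ≠ Fin.last N) :
    ∃ (b : Fin N → Fin M) (w : Equiv.Perm (Fin N)),
      rainbow lab (fun i => ((b i).rev : ℕ)) (w.trans Fin.revPerm) ≠
        rainbow lab (fun i => (b i : ℕ)) w := by
  by_contra! hcon
  have h := sum_rainbow_eq_one lab h0 h1
  rw [← Fintype.sum_prod_type'] at h
  have h2 : ∑ q : (Fin N → Fin M) × Equiv.Perm (Fin N),
      rainbow lab (fun i => (q.1 i : ℕ)) q.2 = 0 := by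
    refine Finset.sum_involution
      (fun q _ => (fun i => (q.1 i).rev, q.2.trans Fin.revPerm)) ?_ ?_ ?_ ?_
    · intro q _
      simp only
      rw [hcon]
      exact CharTwo.add_self_eq_zero _
    · intro q _ _ h
      have h3 := congrFun (congrArg Prod.fst h) ⟨0, hN⟩
      have h4 := congrArg Fin.val h3
      simp only [Fin.val_rev] at h4
      obtain ⟨r, hr⟩ := hM2
      have := (q.1 ⟨0, hN⟩).isLt
      omega
    · intros; simp
    · intro q _
      ext <;> simp
  rw [h2] at h
  exact zero_ne_one h

/-! ### Continuous maps with a symmetric labelling near their zeros -/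

/-- A continuous map pointing outwards on the faces of a cube has no labelling that is symmetric
(up to a permutation of the labels) in a symmetric neighbourhood of its zeros. -/
theorem false_of_symmetric_labelling {N : ℕ} (hN : 0 < N) {F : (Fin N → ℝ) → Fin N → ℝ}
    (hF : Continuous F) {L : ℝ} (hL : 0 < L) (lab : (Fin N → ℝ) → Fin (N + 1))
    (hlab : ∀ x i, lab x = i.castSucc → 0 ≤ F x i)
    (hlab' : ∀ x, lab x = Fin.last N → ∀ i, F x i ≤ 0)
    (hneg : ∀ x i, x i = -L → F x i < 0) (hpos : ∀ x i, x i = L → 0 < F x i)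
    {W : Set (Fin N → ℝ)} (hW : IsOpen W) (hzero : ∀ x, F x = 0 → x ∈ W)
    (τ : Equiv.Perm (Fin (N + 1))) (hsymm : ∀ x ∈ W, lab (-x) = τ (lab x)) : False := by
  set Q : Set (Fin N → ℝ) := Set.pi univ fun _ => Icc (-L) L with hQ
  have hQc : IsCompact Q := isCompact_univ_pi fun _ => isCompact_Icc
  obtain ⟨c, hc, hcF⟩ : ∃ c > 0, ∀ x ∈ Q \ W, c ≤ ‖F x‖ := by
    rcases (Q \ W).eq_empty_or_nonempty with h | h
    · exact ⟨1, one_pos, by simp [h]⟩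
    · obtain ⟨x, hx, hmin⟩ := (hQc.diff hW).exists_isMinOn h hF.norm.continuousOn
      refine ⟨‖F x‖, norm_pos_iff.2 fun h0 => hx.2 (hzero x h0), fun y hy => hmin hy⟩
  obtain ⟨δ, hδ, hδF⟩ := Metric.uniformContinuousOn_iff.1
    (hQc.uniformContinuousOn_of_continuous hF.continuousOn) c hc
  obtain ⟨m, hm⟩ := exists_nat_gt (L / δ)
  have hm0 : (0 : ℝ) < m := (div_pos hL hδ).trans hm
  have hmesh : L / m < δ := by
    rw [div_lt_iff₀ hδ] at hm
    rw [div_lt_iff₀ hm0]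
    linarith
  set g : (Fin N → ℕ) → Fin N → ℝ := fun x i => L * ((x i : ℝ) / m - 1) with hg
  obtain ⟨b, w, hbw⟩ := exists_rainbow_ne (M := m + m) ⟨m, rfl⟩ hN (fun x => lab (g x))
    (by
      intro x i hx h
      have h1 := hlab _ _ h
      have h2 := hneg (g x) i (by simp [hg, hx])
      linarith)
    (by
      intro x i hx h
      have h1 := hlab' _ h i
      have h2 := hpos (g x) i (by
        simp only [hg, hx]
        push_cast
        field_simp
        ring)
      linarith)
  have hmem : ∀ (b : Fin N → Fin (m + m)) (w : Equiv.Perm (Fin N)) (k : Fin (N + 1)),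
      g (kuhnVertex (fun i => (b i : ℕ)) w k) ∈ Q := by
    intro b w k i _
    have h1 : kuhnVertex (fun i => (b i : ℕ)) w k i ≤ m + m := by
      have := (b i).isLt
      simp only [kuhnVertex]
      split_ifs <;> omega
    have h2 : ((kuhnVertex (fun i => (b i : ℕ)) w k i : ℕ) : ℝ) / m ≤ 2 := by
      rw [div_le_iff₀ hm0]
      have : ((kuhnVertex (fun i => (b i : ℕ)) w k i : ℕ) : ℝ) ≤ ((m + m : ℕ) : ℝ) := by
        exact_mod_cast h1
      push_cast at this
      linarith
    have h3 : 0 ≤ ((kuhnVertex (fun i => (b i : ℕ)) w k i : ℕ) : ℝ) / m := by positivity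
    simp only [hg, mem_Icc]
    constructor <;> nlinarith
  have hclose : ∀ (b : Fin N → Fin (m + m)) (w : Equiv.Perm (Fin N)) (k l : Fin (N + 1)),
      dist (g (kuhnVertex (fun i => (b i : ℕ)) w k)) (g (kuhnVertex (fun i => (b i : ℕ)) w l))
        < δ := by
    intro b w k l
    refine lt_of_le_of_lt ((dist_pi_le_iff (by positivity)).2 fun i => ?_) hmesh
    rw [Real.dist_eq]
    have : L * ((kuhnVertex (fun i => (b i : ℕ)) w k i : ℝ) / m - 1) -
        L * ((kuhnVertex (fun i => (b i : ℕ)) w l i : ℝ) / m - 1) =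
        (L / m) * ((kuhnVertex (fun i => (b i : ℕ)) w k i : ℝ) -
          (kuhnVertex (fun i => (b i : ℕ)) w l i : ℝ)) := by ring
    simp only [hg]
    rw [this, abs_mul, abs_of_pos (div_pos hL hm0)]
    refine mul_le_of_le_one_right (by positivity) ?_
    unfold kuhnVertex
    split_ifs <;> simp
  have hin : ∀ (b : Fin N → Fin (m + m)) (w : Equiv.Perm (Fin N)),
      Function.Injective (fun k : Fin (N + 1) => lab (g (kuhnVertex (fun i => (b i : ℕ)) w k))) →
      ∀ k : Fin (N + 1), g (kuhnVertex (fun i => (b i : ℕ)) w k) ∈ W := by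
    intro b w hinj k
    by_contra hk
    have h1 := hcF _ ⟨hmem b w k, hk⟩
    refine absurd h1 (not_le.2 ((pi_norm_lt_iff hc).2 fun i => ?_))
    have hsurj := Finite.injective_iff_surjective.1 hinj
    obtain ⟨p, hp⟩ := hsurj i.castSucc
    obtain ⟨q, hq⟩ := hsurj (Fin.last N)
    have h2 := hlab _ _ hp
    have h3 := hlab' _ hq i
    have h4 := (dist_le_pi_dist _ _ i).trans_lt
      (hδF _ (hmem b w k) _ (hmem b w p) (hclose b w k p))
    have h5 := (dist_le_pi_dist _ _ i).trans_lt
      (hδF _ (hmem b w k) _ (hmem b w q) (hclose b w k q))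
    rw [Real.dist_eq, abs_lt] at h4 h5
    rw [Real.norm_eq_abs, abs_lt]
    constructor <;> linarith
  have hrefl : ∀ (b : Fin N → Fin (m + m)) (w : Equiv.Perm (Fin N)) (k : Fin (N + 1)),
      g (kuhnVertex (fun i => ((b i).rev : ℕ)) (w.trans Fin.revPerm) k) =
        -g (kuhnVertex (fun i => (b i : ℕ)) w (k.rev : Fin (N + 1))) := by
    intro b w k
    funext i
    have h := kuhnVertex_reflect b w k i
    have h' : ((kuhnVertex (fun i => ((b i).rev : ℕ)) (w.trans Fin.revPerm) k i : ℕ) : ℝ) =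
        (m + m) - (kuhnVertex (fun i => (b i : ℕ)) w (k.rev : Fin (N + 1)) i : ℕ) := by
      rw [eq_sub_iff_add_eq]
      exact_mod_cast h
    simp only [hg, Pi.neg_apply, h']
    field_simp
    ring
  have himp : ∀ (b : Fin N → Fin (m + m)) (w : Equiv.Perm (Fin N)),
      Function.Injective (fun k : Fin (N + 1) => lab (g (kuhnVertex (fun i => (b i : ℕ)) w k))) →
      Function.Injective (fun k : Fin (N + 1) =>
        lab (g (kuhnVertex (fun i => ((b i).rev : ℕ)) (w.trans Fin.revPerm) k))) := by
    intro b w hinj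
    have : (fun k : Fin (N + 1) =>
        lab (g (kuhnVertex (fun i => ((b i).rev : ℕ)) (w.trans Fin.revPerm) k))) =
        τ ∘ (fun k : Fin (N + 1) => lab (g (kuhnVertex (fun i => (b i : ℕ)) w k))) ∘ Fin.rev := by
      funext k
      simp only [Function.comp, hrefl]
      exact hsymm _ (hin b w hinj _)
    rw [this]
    exact τ.injective.comp (hinj.comp Fin.rev_injective)
  apply hbw
  unfold rainbow
  congr 1
  apply propext
  refine ⟨fun h => ?_, himp b w⟩
  have h2 := himp (fun i => (b i).rev) (w.trans Fin.revPerm) h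
  have h3 : (w.trans Fin.revPerm).trans Fin.revPerm = w := by ext; simp
  simpa [h3] using h2

/-! ### Reflection in the hyperplane orthogonal to a nonzero vector -/

/-- Reflection in the hyperplane orthogonal to `u`. -/
def hyperplaneRefl {n : ℕ} (u z : Eu n) : Eu n := z - (2 * ⟪u, z⟫ / ‖u‖ ^ 2) • u

lemma hyperplaneRefl_hyperplaneRefl {n : ℕ} {u : Eu n} (hu : u ≠ 0) (z : Eu n) :
    hyperplaneRefl u (hyperplaneRefl u z) = z := by
  have h : ‖u‖ ^ 2 ≠ 0 := by positivity
  have h2 : (2 * ⟪u, z - (2 * ⟪u, z⟫ / ‖u‖ ^ 2) • u⟫ / ‖u‖ ^ 2 : ℝ) = -(2 * ⟪u, z⟫ / ‖u‖ ^ 2) := by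
    rw [inner_sub_right, inner_smul_right, real_inner_self_eq_norm_sq]
    field_simp
    ring
  simp only [hyperplaneRefl]
  rw [h2]
  module

lemma hyperplaneRefl_zero_right {n : ℕ} (u : Eu n) : hyperplaneRefl u 0 = 0 := by
  simp [hyperplaneRefl]

lemma eq_zero_of_hyperplaneRefl_eq_zero {n : ℕ} {u : Eu n} (hu : u ≠ 0) {z : Eu n}
    (h : hyperplaneRefl u z = 0) : z = 0 := by
  rw [← hyperplaneRefl_hyperplaneRefl hu z, h, hyperplaneRefl_zero_right]

lemma ContinuousOn.hyperplaneRefl {n : ℕ} {X : Type*} [TopologicalSpace X] {s : Set X}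
    {u z : X → Eu n} (hu : ContinuousOn u s) (hz : ContinuousOn z s) (h0 : ∀ x ∈ s, u x ≠ 0) :
    ContinuousOn (fun x => hyperplaneRefl (u x) (z x)) s := by
  unfold _root_.hyperplaneRefl
  refine hz.sub (ContinuousOn.smul (ContinuousOn.div ?_ (hu.norm.pow 2) fun x hx => ?_) hu)
  · exact continuousOn_const.mul (hu.inner hz)
  · exact pow_ne_zero 2 (norm_ne_zero_iff.2 (h0 x hx))

lemma hyperplaneRefl_neg_single {n : ℕ} (z : Eu n) (i : Fin (n + 1)) :
    hyperplaneRefl (-EuclideanSpace.single (Fin.last n) (1 : ℝ)) z i =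
      if i = Fin.last n then -z i else z i := by
  have h : (⟪EuclideanSpace.single (Fin.last n) (1 : ℝ), z⟫ : ℝ) = z (Fin.last n) := by
    simp [EuclideanSpace.inner_single_left]
  simp only [hyperplaneRefl, inner_neg_left, h, norm_neg, PiLp.norm_single]
  split_ifs with hi
  · subst hi
    simp
    ring
  · simp [hi]

/-! ### Nonexistence of maps equivariant with respect to the reflections -/

/-- Label of a vector: a coordinate at which it is positive, if there is one, preferably not the
last one; the extra label otherwise. -/
def signLabel {n : ℕ} (z : Eu n) : Fin (n + 2) :=
  if h : ∃ i : Fin n, 0 < z i.castSucc then h.choose.castSucc.castSucc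
  else if 0 < z (Fin.last n) then (Fin.last n).castSucc else Fin.last (n + 1)

lemma signLabel_cases {n : ℕ} (z : Eu n) :
    (∃ i : Fin n, signLabel z = i.castSucc.castSucc ∧ 0 < z i.castSucc) ∨
    (signLabel z = (Fin.last n).castSucc ∧ 0 < z (Fin.last n) ∧ ∀ i : Fin n, z i.castSucc ≤ 0) ∨
    (signLabel z = Fin.last (n + 1) ∧ ∀ i, z i ≤ 0) := by
  unfold signLabel
  split_ifs with h h'
  · exact .inl ⟨_, rfl, h.choose_spec⟩
  · exact .inr (.inl ⟨rfl, h', fun i => not_lt.1 fun hi => h ⟨i, hi⟩⟩)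
  · refine .inr (.inr ⟨rfl, fun i => ?_⟩)
    induction i using Fin.lastCases with
    | last => exact not_lt.1 h'
    | cast i => exact not_lt.1 fun hi => h ⟨i, hi⟩

/-- The permutation of the labels induced by flipping the sign of the last coordinate. -/
def labelSwap (n : ℕ) : Equiv.Perm (Fin (n + 2)) :=
  Equiv.swap (Fin.last n).castSucc (Fin.last (n + 1))

lemma labelSwap_labelSwap {n : ℕ} (i : Fin (n + 2)) : labelSwap n (labelSwap n i) = i := by
  simp [labelSwap]

lemma nonneg_of_signLabel {n : ℕ} {z : Eu n} {i : Fin (n + 1)} (h : signLabel z = i.castSucc) :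
    0 ≤ z i := by
  rcases signLabel_cases z with ⟨j, hj, hz⟩ | ⟨hj, hz, _⟩ | ⟨hj, _⟩ <;> rw [hj] at h
  · rw [← Fin.castSucc_injective _ h]; exact hz.le
  · rw [← Fin.castSucc_injective _ h]; exact hz.le
  · exact absurd h (Fin.castSucc_lt_last i).ne'

lemma nonpos_of_signLabel {n : ℕ} {z : Eu n} (h : signLabel z = Fin.last (n + 1))
    (i : Fin (n + 1)) : z i ≤ 0 := by
  rcases signLabel_cases z with ⟨j, hj, hz⟩ | ⟨hj, hz, _⟩ | ⟨hj, hz⟩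
  · rw [hj] at h; exact absurd h (Fin.castSucc_lt_last _).ne
  · rw [hj] at h; exact absurd h (Fin.castSucc_lt_last _).ne
  · exact hz i

lemma nonneg_of_labelSwap_signLabel {n : ℕ} {z : Eu n} {i : Fin (n + 1)}
    (h : labelSwap n (signLabel z) = i.castSucc) :
    0 ≤ hyperplaneRefl (-EuclideanSpace.single (Fin.last n) (1 : ℝ)) z i := by
  rw [hyperplaneRefl_neg_single]
  rcases signLabel_cases z with ⟨j, hj, hz⟩ | ⟨hj, hz, _⟩ | ⟨hj, hz⟩ <;>
    rw [hj, labelSwap] at h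
  · rw [Equiv.swap_apply_of_ne_of_ne
      (fun h => (Fin.castSucc_lt_last j).ne (Fin.castSucc_injective _ h))
      (Fin.castSucc_lt_last _).ne] at h
    rw [← Fin.castSucc_injective _ h, if_neg (Fin.castSucc_lt_last j).ne]
    exact hz.le
  · rw [Equiv.swap_apply_left] at h
    exact absurd h (Fin.castSucc_lt_last i).ne'
  · rw [Equiv.swap_apply_right] at h
    rw [← Fin.castSucc_injective _ h, if_pos rfl]
    linarith [hz (Fin.last n)]

lemma nonpos_of_labelSwap_signLabel {n : ℕ} {z : Eu n}
    (h : labelSwap n (signLabel z) = Fin.last (n + 1)) (i : Fin (n + 1)) :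
    hyperplaneRefl (-EuclideanSpace.single (Fin.last n) (1 : ℝ)) z i ≤ 0 := by
  rw [hyperplaneRefl_neg_single]
  rcases signLabel_cases z with ⟨j, hj, hz⟩ | ⟨hj, hz, hz'⟩ | ⟨hj, hz⟩ <;>
    rw [hj, labelSwap] at h
  · rw [Equiv.swap_apply_of_ne_of_ne
      (fun h => (Fin.castSucc_lt_last j).ne (Fin.castSucc_injective _ h))
      (Fin.castSucc_lt_last _).ne] at h
    exact absurd h (Fin.castSucc_lt_last _).ne
  · split_ifs with hi
    · subst hi; linarith
    · obtain ⟨j, rfl⟩ := Fin.exists_castSucc_eq.2 hi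
      exact hz' j
  · rw [Equiv.swap_apply_right] at h
    exact absurd h (Fin.castSucc_lt_last _).ne

theorem false_of_hyperplaneRefl_equivariant {n : ℕ} {G : Eu n → Eu n} (hG : Continuous G)
    (hdist : ∀ x, ‖G x - x‖ ≤ 12 / 5) (hin : ∀ x, ‖x‖ < 8 / 5 → G x ≠ 0)
    (hsymm : ∀ x, 3 / 2 ≤ ‖x‖ → G (-x) = hyperplaneRefl x (G x))
    (hlast : ∀ x, x (Fin.last n) = 0 → G x ≠ 0) : False := by
  set e : Eu n := EuclideanSpace.single (Fin.last n) (1 : ℝ) with he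
  have hel : e (Fin.last n) = 1 := by simp [he]
  have hlc : Continuous fun x : Eu n => x (Fin.last n) := by fun_prop
  -- the last coordinate is bounded away from zero on the zeros of `G`
  have hzn : ∀ x, G x = 0 → 8 / 5 ≤ ‖x‖ ∧ ‖x‖ ≤ 12 / 5 := fun x hx =>
    ⟨not_lt.1 fun h => hin x h hx, by simpa [hx] using hdist x⟩
  obtain ⟨η, hη, hηG⟩ : ∃ η > 0, ∀ x, G x = 0 → η ≤ |x (Fin.last n)| := by
    have hZ : IsCompact {x | G x = 0} := by
      refine (isCompact_closedBall (0 : Eu n) (12 / 5)).of_isClosed_subset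
        (isClosed_eq hG continuous_const) fun x hx => ?_
      simpa using (hzn x hx).2
    rcases {x | G x = 0}.eq_empty_or_nonempty with h | h
    · exact ⟨1, one_pos, fun x hx => absurd (show x ∈ {x | G x = 0} from hx) (by simp [h])⟩
    · obtain ⟨x, hx, hmin⟩ := hZ.exists_isMinOn h hlc.abs.continuousOn
      exact ⟨_, abs_pos.2 fun h0 => hlast x h0 hx, fun y hy => hmin hy⟩
  obtain ⟨κ, hκ, hκη, hκ1⟩ : ∃ κ > 0, κ < η ∧ κ < 1 / 10 :=
    ⟨min η (1 / 10) / 2, by positivity, by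
      have := min_le_left η (1 / 10)
      linarith [lt_min hη (show (0 : ℝ) < 1 / 10 by norm_num)], by
      have := min_le_right η (1 / 10)
      linarith [lt_min hη (show (0 : ℝ) < 1 / 10 by norm_num)]⟩
  set m : Eu n → ℝ := fun x => min (-x (Fin.last n)) (min (‖x‖ - 3 / 2) (3 - ‖x‖)) with hm
  have hmc : Continuous m := by fun_prop
  set s : Eu n → ℝ := fun x => min 1 (m x / κ) with hs
  have hsc : Continuous s := by fun_prop
  set u : Eu n → Eu n := fun x => (1 - s x) • x - s x • e with hu
  have huc : Continuous u := by fun_prop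
  have hu0 : ∀ x, 0 ≤ m x → u x ≠ 0 := by
    intro x hx h0
    have h1 : x (Fin.last n) ≤ 0 := by
      have := hx.trans (min_le_left _ _); linarith
    have h2 : 3 / 2 ≤ ‖x‖ := by
      have := hx.trans ((min_le_right _ _).trans (min_le_left _ _)); linarith
    have hs0 : 0 ≤ s x := le_min zero_le_one (by positivity)
    have hs1 : s x ≤ 1 := min_le_left _ _
    have h3 : u x (Fin.last n) = (1 - s x) * x (Fin.last n) - s x := by
      simp [hu, hel]
    rw [h0] at h3
    have h4 : s x = 0 := by
      simp at h3
      nlinarith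
    have h5 : u x = x := by simp [hu, h4]
    rw [h5] at h0
    rw [h0] at h2
    norm_num at h2
  set F : Eu n → Eu n := fun x => if m x ≤ 0 then G x else hyperplaneRefl (u x) (G (-x)) with hF
  have hFc : Continuous F := by
    refine continuous_if_le hmc continuous_const hG.continuousOn ?_ ?_
    · exact huc.continuousOn.hyperplaneRefl (hG.comp continuous_neg).continuousOn hu0
    · intro x hx
      have h2 : 3 / 2 ≤ ‖x‖ := by
        have := hx.ge.trans ((min_le_right _ _).trans (min_le_left _ _)); linarith
      have h3 : u x = x := by simp [hu, hs, hx]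
      have h4 : x ≠ 0 := fun h => by rw [h] at h2; norm_num at h2
      rw [h3, hsymm x h2, hyperplaneRefl_hyperplaneRefl h4]
  have hFW : ∀ x, κ < m x → F x = hyperplaneRefl (-e) (G (-x)) := by
    intro x hx
    have h1 : s x = 1 := min_eq_left (by rw [le_div_iff₀ hκ]; linarith)
    simp only [hF, hu, h1]
    rw [if_neg (by linarith)]
    simp
  have hmneg : ∀ x, 0 < m x → F (-x) = G (-x) := by
    intro x hx
    have h1 : 0 < -x (Fin.last n) := hx.trans_le (min_le_left _ _)
    have h2 : m (-x) ≤ 0 := (min_le_left _ _).trans (by simpa using by linarith)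
    simp only [hF, if_pos h2]
  have hGm : ∀ x, G x = 0 → 0 < x (Fin.last n) → κ < m (-x) := by
    intro x hx hx0
    have h1 := hηG x hx
    have h2 := hzn x hx
    rw [abs_of_pos hx0] at h1
    simp only [hm, norm_neg, lt_min_iff]
    refine ⟨?_, ?_, ?_⟩
    · simp; linarith
    · linarith
    · linarith
  have hGm' : ∀ x, G x = 0 → x (Fin.last n) ≤ 0 → 0 < m x := by
    intro x hx hx0
    have h1 := hηG x hx
    have h2 := hzn x hx
    rw [abs_of_nonpos hx0] at h1
    simp only [hm, lt_min_iff]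
    exact ⟨by linarith, by linarith, by linarith⟩
  have hzero : ∀ x, F x = 0 → κ < m x ∨ κ < m (-x) := by
    intro x hx
    by_cases h : m x ≤ 0
    · have hx' : G x = 0 := by simpa [hF, h] using hx
      right
      exact hGm x hx' (not_le.1 fun h0 => absurd (hGm' x hx' h0) (not_lt.2 h))
    · have hx' : hyperplaneRefl (u x) (G (-x)) = 0 := by simpa [hF, h] using hx
      have h0 := eq_zero_of_hyperplaneRefl_eq_zero (hu0 x (not_le.1 h).le) hx'
      left
      have h1 : 0 < -x (Fin.last n) := (not_le.1 h).trans_le (min_le_left _ _)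
      simpa using hGm (-x) h0 (by simpa using h1)
  have hFG : ∀ x : Eu n, 3 ≤ ‖x‖ → F x = G x := by
    intro x hx
    have h2 : m x ≤ 0 := (min_le_right _ _).trans ((min_le_right _ _).trans (by linarith))
    simp only [hF, if_pos h2]
  set ψ : (Fin (n + 1) → ℝ) → Eu n := fun x => WithLp.toLp 2 x with hψ
  have hψc : Continuous ψ := by fun_prop
  have hbd : ∀ x i, |x i| = 4 → |F (ψ x) i - x i| < 4 := by
    intro x i hx
    have h1 : |x i| ≤ ‖ψ x‖ := by simpa [hψ] using PiLp.norm_apply_le (ψ x) i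
    rw [hFG _ (by linarith)]
    have h2 := hdist (ψ x)
    have h3 : |G (ψ x) i - x i| ≤ ‖G (ψ x) - ψ x‖ := by
      simpa [hψ] using PiLp.norm_apply_le (G (ψ x) - ψ x) i
    linarith
  refine false_of_symmetric_labelling (N := n + 1) n.succ_pos
    (F := fun x => (F (ψ x)).ofLp) (by fun_prop) (L := 4) (by norm_num)
    (fun x => if κ < m (ψ x) then labelSwap n (signLabel (G (-ψ x))) else signLabel (F (ψ x)))
    ?_ ?_ ?_ ?_ (W := {x | κ < m (ψ x) ∨ κ < m (-ψ x)}) ?_ ?_ (labelSwap n) ?_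
  · intro x i hx
    split_ifs at hx with h
    · simp only [hFW _ h]
      exact nonneg_of_labelSwap_signLabel hx
    · exact nonneg_of_signLabel hx
  · intro x hx i
    split_ifs at hx with h
    · simp only [hFW _ h]
      exact nonpos_of_labelSwap_signLabel hx i
    · exact nonpos_of_signLabel hx i
  · intro x i hx
    have := hbd x i (by rw [hx]; norm_num)
    rw [abs_lt] at this
    linarith [this.2]
  · intro x i hx
    have := hbd x i (by rw [hx]; norm_num)
    rw [abs_lt] at this
    linarith [this.1]
  · exact (isOpen_lt continuous_const (hmc.comp hψc)).union
      (isOpen_lt continuous_const (hmc.comp hψc.neg))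
  · intro x hx
    refine hzero (ψ x) ?_
    ext i
    exact congrFun hx i
  · intro x hx
    have hψn : ψ (-x) = -ψ x := by simp [hψ]
    simp only [hψn, neg_neg]
    have hnot : ∀ y, κ < m y → ¬ κ < m (-y) := by
      intro y hy hy'
      have h1 := (hκ.trans hy).trans_le (min_le_left _ _)
      have h2 := (hκ.trans hy').trans_le (min_le_left _ _)
      simp at h1 h2
      linarith
    rcases hx with h | h
    · rw [if_neg (hnot _ h), if_pos h, labelSwap_labelSwap, hmneg _ (hκ.trans h)]
    · have h' : ¬ κ < m (ψ x) := by simpa using hnot _ h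
      have := hmneg _ (hκ.trans h)
      rw [neg_neg] at this
      rw [if_pos h, if_neg h', this]

lemma Refl_neg_left {n : ℕ} (p x : Eu n) : Refl (-p) x = Refl p x := by
  simp [Refl]

lemma Refl_neg_right {n : ℕ} (p x : Eu n) : Refl p (-x) = -Refl p x := by
  simp only [Refl, inner_neg_right]
  module

lemma Refl_add {n : ℕ} (p x y : Eu n) : Refl p (x + y) = Refl p x + Refl p y := by
  simp only [Refl, inner_add_right]
  module

lemma Refl_sub {n : ℕ} (p x y : Eu n) : Refl p (x - y) = Refl p x - Refl p y := by
  simp only [Refl, inner_sub_right]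
  module

lemma Refl_smul {n : ℕ} (c : ℝ) (p x : Eu n) : Refl p (c • x) = c • Refl p x := by
  simp only [Refl, inner_smul_right]
  module

lemma inner_Refl_Refl {n : ℕ} {p : Eu n} (hp : ‖p‖ = 1) (x y : Eu n) :
    (⟪Refl p x, Refl p y⟫ : ℝ) = ⟪x, y⟫ := by
  simp only [Refl, inner_sub_left, inner_sub_right, inner_smul_left, inner_smul_right,
    real_inner_self_eq_norm_sq, hp, real_inner_comm p x]
  simp
  ring

lemma norm_Refl {n : ℕ} {p : Eu n} (hp : ‖p‖ = 1) (x : Eu n) : ‖Refl p x‖ = ‖x‖ := by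
  rw [← sq_eq_sq₀ (norm_nonneg _) (norm_nonneg _), ← real_inner_self_eq_norm_sq,
    inner_Refl_Refl hp, real_inner_self_eq_norm_sq]

lemma Refl_Refl {n : ℕ} {p : Eu n} (hp : ‖p‖ = 1) (x : Eu n) : Refl p (Refl p x) = x := by
  simp only [Refl, inner_sub_right, inner_smul_right, real_inner_self_eq_norm_sq, hp]
  module

lemma Refl_of_inner_eq_zero {n : ℕ} {p x : Eu n} (h : (⟪p, x⟫ : ℝ) = 0) : Refl p x = x := by
  simp [Refl, h]

lemma Refl_self {n : ℕ} {p : Eu n} (hp : ‖p‖ = 1) : Refl p p = -p := by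
  simp only [Refl, real_inner_self_eq_norm_sq, hp]
  module

lemma hyperplaneRefl_eq_Refl {n : ℕ} (x z : Eu n) :
    hyperplaneRefl x z = Refl (‖x‖⁻¹ • x) z := by
  simp only [hyperplaneRefl, Refl, inner_smul_left, smul_smul]
  congr 2
  simp
  ring

lemma mem_sphSet {n : ℕ} {x : Eu n} : x ∈ sphSet n ↔ ‖x‖ = 1 := by simp [sphSet]

lemma neg_mem_sphSet {n : ℕ} {x : Eu n} (h : x ∈ sphSet n) : -x ∈ sphSet n := by
  rw [mem_sphSet] at h ⊢
  simpa using h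

lemma normalize_mem_sphSet {n : ℕ} {x : Eu n} (h : x ≠ 0) : ‖x‖⁻¹ • x ∈ sphSet n := by
  rw [mem_sphSet, norm_smul, norm_inv, norm_norm, inv_mul_cancel₀ (norm_ne_zero_iff.2 h)]

lemma norm_sub_inner_smul_le {n : ℕ} {p : Eu n} (hp : ‖p‖ = 1) (v : Eu n) :
    ‖v - (⟪p, v⟫ : ℝ) • p‖ ≤ ‖v‖ := by
  rw [← sq_le_sq₀ (norm_nonneg _) (norm_nonneg _), ← real_inner_self_eq_norm_sq,
    ← real_inner_self_eq_norm_sq]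
  simp only [inner_sub_left, inner_sub_right, inner_smul_left, inner_smul_right,
    real_inner_self_eq_norm_sq, hp, real_inner_comm p v]
  simp
  nlinarith [sq_nonneg (⟪v, p⟫ : ℝ)]

/-- An equivariant map on the sphere has an equivariant perturbation that is nowhere normal to
the sphere along the equator. -/
lemma exists_perturbation_ne_smul {n : ℕ} {φ : Eu n → Eu n} (hφ : ContinuousOn φ (sphSet n))
    (hsymm : ∀ p ∈ sphSet n, φ (-p) = Refl p (φ p)) :
    ∃ φ' : Eu n → Eu n, ContinuousOn φ' (sphSet n) ∧
      (∀ p ∈ sphSet n, ‖φ' p - φ p‖ ≤ 1 / 5) ∧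
      (∀ p ∈ sphSet n, φ' (-p) = Refl p (φ' p)) ∧
      ∀ p ∈ sphSet n, p (Fin.last n) = 0 → ∀ t : ℝ, φ' p ≠ t • p := by
  obtain ⟨ψ, hψ⟩ := ContinuousMap.exists_restrict_eq (Y := Eu n) (s := sphSet n)
    isClosed_sphere ⟨_, hφ.domRestrict⟩
  have hψφ : ∀ p ∈ sphSet n, ψ p = φ p := fun p hp => by
    simpa using DFunLike.congr_fun hψ ⟨p, hp⟩
  obtain ⟨P, hP, hPψ, -⟩ := ψ.continuous.exists_contDiff_approx (ε := fun _ => 1 / 10) ⊤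
    continuous_const (fun _ => by norm_num)
  set Q : Eu n → Eu n := fun p => (1 / 2 : ℝ) • (P p + Refl p (P (-p))) with hQ
  have hQd : Differentiable ℝ Q := by
    have h1 : Differentiable ℝ P := hP.differentiable (by simp)
    have h2 : Differentiable ℝ fun p => P (-p) := h1.comp differentiable_id.neg
    simp only [hQ, Refl]
    have h3 : Differentiable ℝ fun p : Eu n => (⟪p, P (-p)⟫ : ℝ) := differentiable_id.inner ℝ h2
    fun_prop
  have hQs : ∀ p ∈ sphSet n, Q (-p) = Refl p (Q p) := by
    intro p hp
    rw [mem_sphSet] at hp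
    simp only [hQ, neg_neg, Refl_neg_left, Refl_smul, Refl_add, Refl_Refl hp]
    module
  have hQφ : ∀ p ∈ sphSet n, ‖Q p - φ p‖ ≤ 1 / 10 := by
    intro p hp
    have hp' := mem_sphSet.1 hp
    have h1 : ∀ q ∈ sphSet n, ‖P q - φ q‖ ≤ 1 / 10 := fun q hq => by
      rw [← hψφ q hq, ← dist_eq_norm]; exact (hPψ q).le
    have h2 : Q p - φ p = (1 / 2 : ℝ) • ((P p - φ p) + Refl p (P (-p) - φ (-p))) := by
      rw [Refl_sub, hsymm p hp, Refl_Refl hp']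
      simp only [hQ]
      module
    rw [h2, norm_smul]
    have h3 := norm_add_le (P p - φ p) (Refl p (P (-p) - φ (-p)))
    rw [norm_Refl hp'] at h3
    have h4 := h1 p hp
    have h5 := h1 (-p) (neg_mem_sphSet hp)
    norm_num at *
    linarith
  -- a small vector outside of the null set of normal values along the equator
  set H : Submodule ℝ (Eu n) := LinearMap.ker
    (EuclideanSpace.proj (Fin.last n) : Eu n →L[ℝ] ℝ).toLinearMap with hH
  have hHm : ∀ x : Eu n, x ∈ H ↔ x (Fin.last n) = 0 := fun x => by simp [hH]
  have hH0 : volume (H : Set (Eu n)) = 0 := by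
    refine Measure.addHaar_submodule volume H fun h => ?_
    have := (hHm (EuclideanSpace.single (Fin.last n) 1)).1 (h ▸ Submodule.mem_top)
    simp at this
  set f : ℝ → Eu n → Eu n := fun c x => c • x - Q (‖x‖⁻¹ • x) with hf
  have hnull : ∀ c, volume (f c '' ((H : Set (Eu n)) \ {0})) = 0 := by
    intro c
    refine addHaar_image_eq_zero_of_differentiableOn_of_addHaar_eq_zero volume ?_
      (measure_mono_null sdiff_subset hH0)
    intro x hx
    have hx0 : x ≠ 0 := hx.2
    refine DifferentiableAt.differentiableWithinAt ?_
    have h1 : DifferentiableAt ℝ (fun x : Eu n => ‖x‖⁻¹ • x) x :=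
      ((differentiableAt_id.norm ℝ hx0).inv (norm_ne_zero_iff.2 hx0)).smul differentiableAt_id
    exact (differentiableAt_id.const_smul c).sub ((hQd _).comp x h1)
  obtain ⟨v, hv, hvf⟩ : ∃ v ∈ closedBall (0 : Eu n) (1 / 10),
      v ∉ f 1 '' ((H : Set (Eu n)) \ {0}) ∪ f (-1) '' ((H : Set (Eu n)) \ {0}) ∪
        f 0 '' ((H : Set (Eu n)) \ {0}) := by
    by_contra! h
    have h1 : volume (closedBall (0 : Eu n) (1 / 10)) = 0 := measure_mono_null h
      (measure_union_null (measure_union_null (hnull _) (hnull _)) (hnull _))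
    exact (measure_closedBall_pos volume (0 : Eu n) (by norm_num : (0 : ℝ) < 1 / 10)).ne' h1
  have hv' : ‖v‖ ≤ 1 / 10 := by simpa using hv
  refine ⟨fun p => Q p + (v - (⟪p, v⟫ : ℝ) • p), ?_, ?_, ?_, ?_⟩
  · exact (hQd.continuous.add (by fun_prop)).continuousOn
  · intro p hp
    have h1 := norm_sub_inner_smul_le (mem_sphSet.1 hp) v
    have h2 := hQφ p hp
    calc _ = ‖(Q p - φ p) + (v - (⟪p, v⟫ : ℝ) • p)‖ := by congr 1; module
      _ ≤ _ := norm_add_le _ _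
      _ ≤ 1 / 5 := by linarith
  · intro p hp
    have h1 : (⟪p, v - (⟪p, v⟫ : ℝ) • p⟫ : ℝ) = 0 := by
      rw [inner_sub_right, inner_smul_right, real_inner_self_eq_norm_sq, mem_sphSet.1 hp]
      ring
    beta_reduce
    rw [hQs p hp, Refl_add, Refl_of_inner_eq_zero h1]
    simp
  · intro p hp hp0 t ht
    have hpn := mem_sphSet.1 hp
    have hp1 : p ≠ 0 := fun h => by simp [h] at hpn
    set c := t + ⟪p, v⟫ with hc
    have h1 : v = c • p - Q p := by
      rw [hc, add_smul, ← ht]; module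
    have hpos : ∀ a : ℝ, 0 < a → ‖a • p‖⁻¹ • (a • p) = p := fun a ha => by
      rw [norm_smul, hpn, smul_smul, Real.norm_of_nonneg ha.le, mul_one, inv_mul_cancel₀ ha.ne',
        one_smul]
    have hmem : ∀ a : ℝ, 0 < a → a • p ∈ (H : Set (Eu n)) \ {0} := fun a ha =>
      ⟨H.smul_mem _ ((hHm p).2 hp0), smul_ne_zero ha.ne' hp1⟩
    refine hvf ?_
    rcases lt_trichotomy c 0 with h | h | h
    · exact .inl (.inr ⟨(-c) • p, hmem _ (by linarith), by
        simp only [hf, hpos (-c) (by linarith), h1]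
        module⟩)
    · exact .inr ⟨p, by simpa using hmem 1 one_pos, by
        have := hpos 1 one_pos
        rw [one_smul] at this
        simp only [hf, this, h1, h]⟩
    · exact .inl (.inl ⟨c • p, hmem _ h, by
        simp only [hf, hpos c h, h1]
        module⟩)

/-- A map of the sphere to itself with `φ (-p) = R_p (φ p)` is not null-homotopic. -/
theorem false_of_homotopy_to_Refl_equivariant {n : ℕ} {Φ : ℝ → Eu n → Eu n}
    (hΦ : ContinuousOn (fun q : ℝ × Eu n => Φ q.1 q.2) (Icc (-1) 0 ×ˢ sphSet n))
    (hunit : ∀ t ∈ Icc (-1 : ℝ) 0, ∀ p ∈ sphSet n, ‖Φ t p‖ = 1) (c : Eu n)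
    (hc : ∀ p ∈ sphSet n, Φ (-1) p = c)
    (hsymm : ∀ p ∈ sphSet n, Φ 0 (-p) = Refl p (Φ 0 p)) : False := by
  have hφ : ContinuousOn (Φ 0) (sphSet n) :=
    hΦ.comp (f := fun p : Eu n => ((0 : ℝ), p)) (by fun_prop) fun p hp =>
      ⟨by norm_num, hp⟩
  obtain ⟨φ', hφ'c, hφ'φ, hφ's, hφ't⟩ := exists_perturbation_ne_smul hφ hsymm
  set H : ℝ × Eu n → Eu n := fun q => Φ (q.1 - 1) q.2 + q.1 • (φ' q.2 - Φ 0 q.2) with hH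
  have hHc : ContinuousOn H (Icc 0 1 ×ˢ sphSet n) := by
    refine ContinuousOn.add ?_ (continuousOn_fst.smul ?_)
    · refine hΦ.comp (f := fun q : ℝ × Eu n => (q.1 - 1, q.2)) (by fun_prop) fun q hq => ?_
      have := hq.1
      exact ⟨⟨by linarith [this.1], by linarith [this.2]⟩, hq.2⟩
    · exact (hφ'c.sub hφ).comp continuousOn_snd fun q hq => hq.2
  have hHn : ∀ q ∈ Icc (0 : ℝ) 1 ×ˢ sphSet n, 4 / 5 ≤ ‖H q‖ ∧ ‖H q‖ ≤ 6 / 5 := by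
    rintro ⟨ρ, p⟩ ⟨hρ, hp⟩
    have hρ' : 0 ≤ ρ ∧ ρ ≤ 1 := hρ
    have h1 := hunit (ρ - 1) ⟨by linarith [hρ'.1], by linarith [hρ'.2]⟩ p hp
    have h2 : ‖ρ • (φ' p - Φ 0 p)‖ ≤ 1 / 5 := by
      rw [norm_smul, Real.norm_of_nonneg hρ'.1]
      nlinarith [hφ'φ p hp, norm_nonneg (φ' p - Φ 0 p), hρ'.2]
    have h3 := norm_add_le (Φ (ρ - 1) p) (ρ • (φ' p - Φ 0 p))
    have h4 := norm_sub_le_norm_add (Φ (ρ - 1) p) (ρ • (φ' p - Φ 0 p))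
    simp only [hH]
    constructor <;> linarith
  have hcn : ‖c‖ = 1 := by
    have h : EuclideanSpace.single (Fin.last n) (1 : ℝ) ∈ sphSet n := by simp [mem_sphSet]
    rw [← hc _ h]
    exact hunit _ (by norm_num) _ h
  set Ψ : Eu n → Eu n := fun x => if x = 0 then c else H (min ‖x‖ 1, ‖x‖⁻¹ • x) with hΨ
  have hmem : ∀ x : Eu n, x ≠ 0 → (min ‖x‖ 1, ‖x‖⁻¹ • x) ∈ Icc (0 : ℝ) 1 ×ˢ sphSet n :=
    fun x hx => ⟨⟨le_min (norm_nonneg _) zero_le_one, min_le_right _ _⟩, normalize_mem_sphSet hx⟩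
  have hΨn : ∀ x, 4 / 5 ≤ ‖Ψ x‖ ∧ ‖Ψ x‖ ≤ 6 / 5 := by
    intro x
    simp only [hΨ]
    split_ifs with hx
    · rw [hcn]; norm_num
    · exact hHn _ (hmem x hx)
  have hΨ1 : ∀ x : Eu n, 1 ≤ ‖x‖ → Ψ x = φ' (‖x‖⁻¹ • x) := by
    intro x hx
    have hx0 : x ≠ 0 := fun h => by rw [h] at hx; norm_num at hx
    simp [hΨ, hx0, hH, min_eq_right hx]
  have hΨc : Continuous Ψ := by
    rw [continuous_iff_continuousAt]
    intro x
    by_cases hx : x = 0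
    · subst hx
      rw [Metric.continuousAt_iff]
      intro ε hε
      have hcomp : IsCompact (Icc (0 : ℝ) 1 ×ˢ sphSet n) :=
        isCompact_Icc.prod (isCompact_sphere _ _)
      obtain ⟨δ, hδ, hδH⟩ := Metric.uniformContinuousOn_iff.1
        (hcomp.uniformContinuousOn_of_continuous hHc) ε hε
      refine ⟨δ, hδ, fun {y} hy => ?_⟩
      by_cases hy0 : y = 0
      · simpa [hy0] using hε
      · have h1 : Ψ 0 = H (0, ‖y‖⁻¹ • y) := by
          simp [hΨ, hH, hc _ (normalize_mem_sphSet hy0)]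
        have h2 : Ψ y = H (min ‖y‖ 1, ‖y‖⁻¹ • y) := by simp [hΨ, hy0]
        rw [h1, h2]
        refine hδH _ (hmem y hy0) _ ⟨by norm_num, normalize_mem_sphSet hy0⟩ ?_
        rw [Prod.dist_eq, dist_self, max_eq_left dist_nonneg, Real.dist_eq, sub_zero,
          abs_of_nonneg (le_min (norm_nonneg _) zero_le_one)]
        rw [dist_zero_right] at hy
        exact (min_le_left _ _).trans_lt hy
    · have hev : Ψ =ᶠ[𝓝 x] fun y => H (min ‖y‖ 1, ‖y‖⁻¹ • y) := by
        filter_upwards [isOpen_ne.mem_nhds hx] with y hy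
        exact if_neg hy
      have h1 : ContinuousOn (fun y : Eu n => H (min ‖y‖ 1, ‖y‖⁻¹ • y)) {y | y ≠ 0} := by
        refine hHc.comp (f := fun y : Eu n => (min ‖y‖ 1, ‖y‖⁻¹ • y)) ?_ fun y hy => hmem y hy
        have h2 : ContinuousOn (fun y : Eu n => ‖y‖⁻¹) {y | y ≠ 0} :=
          continuous_norm.continuousOn.inv₀ fun y hy => norm_ne_zero_iff.2 hy
        fun_prop
      exact (h1.continuousAt (isOpen_ne.mem_nhds hx)).congr hev.symm
  refine false_of_hyperplaneRefl_equivariant (G := fun x => x - (2 : ℝ) • Ψ x) (by fun_prop)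
    ?_ ?_ ?_ ?_
  · intro x
    have := (hΨn x).2
    rw [show x - (2 : ℝ) • Ψ x - x = -((2 : ℝ) • Ψ x) by abel, norm_neg, norm_smul]
    norm_num
    linarith
  · intro x hx h0
    have h1 := (hΨn x).1
    rw [sub_eq_zero.1 h0, norm_smul] at hx
    norm_num at hx
    linarith
  · intro x hx
    have hx0 : x ≠ 0 := fun h => by rw [h] at hx; norm_num at hx
    have h1 : x = ‖x‖ • (‖x‖⁻¹ • x) := by
      rw [smul_smul, mul_inv_cancel₀ (norm_ne_zero_iff.2 hx0), one_smul]
    have hp := normalize_mem_sphSet hx0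
    have h2 : Refl (‖x‖⁻¹ • x) x = -x := by
      conv_lhs => rw [h1, Refl_smul, ← h1, Refl_self (mem_sphSet.1 hp)]
      rw [smul_neg, ← h1]
    rw [hyperplaneRefl_eq_Refl, Refl_sub, Refl_smul, h2, hΨ1 x (by linarith),
      hΨ1 (-x) (by rw [norm_neg]; linarith), norm_neg, smul_neg, hφ's _ hp]
  · intro x hx h0
    have h1 : x = (2 : ℝ) • Ψ x := sub_eq_zero.1 h0
    have h2 : 8 / 5 ≤ ‖x‖ := by
      rw [h1, norm_smul]
      have := (hΨn x).1
      norm_num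
      linarith
    have hx0 : x ≠ 0 := fun h => by rw [h] at h2; norm_num at h2
    refine hφ't _ (normalize_mem_sphSet hx0) (by simp [hx]) (‖x‖ / 2) ?_
    rw [← hΨ1 x (by linarith), smul_smul, div_mul_eq_mul_div,
      mul_inv_cancel₀ (norm_ne_zero_iff.2 hx0)]
    conv_rhs => rw [h1]
    rw [smul_smul]
    norm_num

/-! ### Conformal transformations as projectivized Lorentz transformations -/

/-- The Lorentz form on `ℝ^{n+1} × ℝ`. -/
def lorentzForm {n : ℕ} (v : Eu n × ℝ) : ℝ := ‖v.1‖ ^ 2 - v.2 ^ 2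

/-- The linear map `M` is a positive multiple of a Lorentz transformation, and `f` is the
transformation of the unit sphere it induces. -/
structure Represents {n : ℕ} (M : Eu n × ℝ →ₗ[ℝ] Eu n × ℝ) (f : Eu n → Eu n) : Prop where
  exists_scale : ∃ k > 0, ∀ v, lorentzForm (M v) = k * lorentzForm v
  pos : ∀ x ∈ sphSet n, 0 < (M (x, 1)).2
  eq : ∀ x ∈ sphSet n, M (x, 1) = (M (x, 1)).2 • (f x, (1 : ℝ))

lemma Represents.mapsTo {n : ℕ} {M : Eu n × ℝ →ₗ[ℝ] Eu n × ℝ} {f : Eu n → Eu n}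
    (h : Represents M f) {x : Eu n} (hx : x ∈ sphSet n) : f x ∈ sphSet n := by
  obtain ⟨k, -, hk⟩ := h.exists_scale
  have h1 := hk (x, 1)
  have h2 := h.pos x hx
  rw [h.eq x hx] at h1
  simp only [lorentzForm, Prod.smul_fst, Prod.smul_snd, smul_eq_mul, mem_sphSet.1 hx, norm_smul,
    Real.norm_of_nonneg h2.le, mul_one] at h1
  have h3 : (M (x, 1)).2 ^ 2 * (‖f x‖ ^ 2 - 1) = 0 := by linarith
  have h4 : ‖f x‖ ^ 2 = 1 := by
    rcases mul_eq_zero.1 h3 with h | h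
    · exact absurd h (by positivity)
    · linarith
  rw [mem_sphSet]
  exact by nlinarith [norm_nonneg (f x)]

lemma Represents.comp {n : ℕ} {M N : Eu n × ℝ →ₗ[ℝ] Eu n × ℝ} {f g : Eu n → Eu n}
    (hg : Represents N g) (hf : Represents M f) : Represents (N ∘ₗ M) (g ∘ f) := by
  have key : ∀ x ∈ sphSet n, N (M (x, 1)) = ((M (x, 1)).2 * (N (f x, 1)).2) • (g (f x), (1 : ℝ)) :=
    fun x hx => by
      conv_lhs => rw [hf.eq x hx, map_smul, hg.eq _ (hf.mapsTo hx)]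
      rw [smul_smul]
  refine ⟨?_, fun x hx => ?_, fun x hx => ?_⟩
  · obtain ⟨k, hk0, hk⟩ := hf.exists_scale
    obtain ⟨l, hl0, hl⟩ := hg.exists_scale
    exact ⟨l * k, by positivity, fun v => by simp [hl, hk, mul_assoc]⟩
  · rw [LinearMap.comp_apply, key x hx]
    simpa using mul_pos (hf.pos x hx) (hg.pos _ (hf.mapsTo hx))
  · rw [LinearMap.comp_apply, key x hx]
    simp

/-- The linear map inducing `dMap ξ`. -/
def dLin {n : ℕ} (ξ : Eu n) : Eu n × ℝ →ₗ[ℝ] Eu n × ℝ where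
  toFun v := ((1 - ‖ξ‖ ^ 2) • v.1 + (2 * ⟪ξ, v.1⟫ + 2 * v.2) • ξ,
    2 * ⟪ξ, v.1⟫ + (1 + ‖ξ‖ ^ 2) * v.2)
  map_add' v u := by
    ext1
    · simp only [Prod.fst_add, Prod.snd_add, inner_add_right]
      module
    · simp only [Prod.fst_add, Prod.snd_add, inner_add_right]
      ring
  map_smul' c v := by
    ext1
    · simp only [Prod.smul_fst, Prod.smul_snd, inner_smul_right, smul_eq_mul, RingHom.id_apply]
      module
    · simp only [Prod.smul_fst, Prod.smul_snd, inner_smul_right, smul_eq_mul, RingHom.id_apply]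
      ring

/-- The linear map inducing `Refl p`. -/
def reflLin {n : ℕ} (p : Eu n) : Eu n × ℝ →ₗ[ℝ] Eu n × ℝ where
  toFun v := (Refl p v.1, v.2)
  map_add' v u := by simp [Refl_add]
  map_smul' c v := by simp [Refl_smul]

lemma denom_pos {n : ℕ} {ξ x : Eu n} (hξ : ‖ξ‖ < 1) (hx : ‖x‖ = 1) :
    0 < 1 + 2 * ⟪ξ, x⟫ + ‖ξ‖ ^ 2 := by
  have h := neg_le_of_abs_le (abs_real_inner_le_norm ξ x)
  rw [hx, mul_one] at h
  nlinarith

lemma dMap_of_mem {n : ℕ} (ξ : Eu n) {x : Eu n} (hx : x ∈ sphSet n) :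
    dMap ξ x = (1 + 2 * ⟪ξ, x⟫ + ‖ξ‖ ^ 2)⁻¹ • ((1 - ‖ξ‖ ^ 2) • x + (2 * ⟪ξ, x⟫ + 2) • ξ) := by
  simp only [dMap, mem_sphSet.1 hx, one_pow, one_mul]
  congr 3
  ring

lemma represents_dMap {n : ℕ} {ξ : Eu n} (hξ : ‖ξ‖ < 1) : Represents (dLin ξ) (dMap ξ) := by
  refine ⟨⟨(1 - ‖ξ‖ ^ 2) ^ 2, ?_, fun v => ?_⟩, fun x hx => ?_, fun x hx => ?_⟩
  · have : 0 < 1 - ‖ξ‖ ^ 2 := by nlinarith [norm_nonneg ξ]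
    positivity
  · simp only [lorentzForm, dLin, LinearMap.coe_mk, AddHom.coe_mk, ← real_inner_self_eq_norm_sq,
      inner_add_left, inner_add_right, inner_smul_left, inner_smul_right,
      real_inner_comm ξ v.1]
    simp
    ring
  · have := denom_pos hξ (mem_sphSet.1 hx)
    simp only [dLin, LinearMap.coe_mk, AddHom.coe_mk]
    linarith
  · have := denom_pos hξ (mem_sphSet.1 hx)
    rw [dMap_of_mem ξ hx]
    have h2 : (dLin ξ (x, 1)).2 = 1 + 2 * ⟪ξ, x⟫ + ‖ξ‖ ^ 2 := by
      simp only [dLin, LinearMap.coe_mk, AddHom.coe_mk]; ring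
    ext1
    · rw [h2, Prod.smul_fst, smul_smul, mul_inv_cancel₀ this.ne', one_smul]
      simp [dLin]
    · simp

lemma represents_Refl {n : ℕ} {p : Eu n} (hp : ‖p‖ = 1) : Represents (reflLin p) (Refl p) :=
  ⟨⟨1, one_pos, fun v => by simp [lorentzForm, reflLin, norm_Refl hp]⟩,
    fun x _ => by simp [reflLin], fun x _ => by simp [reflLin]⟩

lemma dLin_neg_dLin {n : ℕ} (ξ : Eu n) (v : Eu n × ℝ) :
    dLin (-ξ) (dLin ξ v) = (1 - ‖ξ‖ ^ 2) ^ 2 • v := by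
  have h : (⟪ξ, ξ⟫ : ℝ) = ‖ξ‖ ^ 2 := real_inner_self_eq_norm_sq ξ
  ext1
  · simp only [dLin, LinearMap.coe_mk, AddHom.coe_mk, inner_add_right, inner_smul_right, h,
      inner_neg_left, norm_neg, Prod.smul_fst]
    module
  · simp only [dLin, LinearMap.coe_mk, AddHom.coe_mk, inner_add_right, inner_smul_right, h,
      inner_neg_left, norm_neg, Prod.smul_snd, smul_eq_mul]
    ring

lemma dMap_mem {n : ℕ} {ξ x : Eu n} (hξ : ‖ξ‖ < 1) (hx : x ∈ sphSet n) : dMap ξ x ∈ sphSet n :=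
  (represents_dMap hξ).mapsTo hx

lemma Refl_mem {n : ℕ} {p x : Eu n} (hp : p ∈ sphSet n) (hx : x ∈ sphSet n) :
    Refl p x ∈ sphSet n := by
  rw [mem_sphSet] at *
  rw [norm_Refl hp, hx]

lemma dMap_neg_dMap {n : ℕ} {ξ x : Eu n} (hξ : ‖ξ‖ < 1) (hx : x ∈ sphSet n) :
    dMap (-ξ) (dMap ξ x) = x := by
  have hξ' : ‖-ξ‖ < 1 := by rwa [norm_neg]
  have h1 := ((represents_dMap hξ').comp (represents_dMap hξ)).eq x hx
  rw [LinearMap.comp_apply, dLin_neg_dLin] at h1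
  have h0 : 0 < 1 - ‖ξ‖ ^ 2 := by nlinarith [norm_nonneg ξ]
  have h2 := congrArg Prod.fst h1
  simp only [Prod.smul_fst, Prod.smul_snd, smul_eq_mul, mul_one, Function.comp_apply] at h2
  exact (smul_right_injective _ (by positivity : (1 - ‖ξ‖ ^ 2) ^ 2 ≠ 0) h2).symm

lemma dMap_dMap_neg {n : ℕ} {ξ x : Eu n} (hξ : ‖ξ‖ < 1) (hx : x ∈ sphSet n) :
    dMap ξ (dMap (-ξ) x) = x := by
  simpa using dMap_neg_dMap (ξ := -ξ) (by rwa [norm_neg]) hx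

lemma dMap_zero {n : ℕ} (x : Eu n) : dMap 0 x = x := by
  simp [dMap]

lemma dMap_Refl_Refl {n : ℕ} {p : Eu n} (hp : ‖p‖ = 1) (ξ x : Eu n) :
    dMap (Refl p ξ) (Refl p x) = Refl p (dMap ξ x) := by
  simp only [dMap, inner_Refl_Refl hp, norm_Refl hp, Refl_smul, Refl_add]

lemma ContinuousOn.dMap {n : ℕ} {X : Type*} [TopologicalSpace X] {s : Set X}
    {ξ y : X → Eu n} (hξ : ContinuousOn ξ s) (hy : ContinuousOn y s)
    (hξ1 : ∀ x ∈ s, ‖ξ x‖ < 1) (hy1 : ∀ x ∈ s, y x ∈ sphSet n) :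
    ContinuousOn (fun x => dMap (ξ x) (y x)) s := by
  unfold _root_.dMap
  have h : ContinuousOn (fun x => (⟪ξ x, y x⟫ : ℝ)) s := hξ.inner hy
  have h0 : ∀ x ∈ s, 1 + 2 * ⟪ξ x, y x⟫ + ‖y x‖ ^ 2 * ‖ξ x‖ ^ 2 ≠ 0 := fun x hx => by
    have h1 := mem_sphSet.1 (hy1 x hx)
    have := denom_pos (hξ1 x hx) h1
    rw [h1]
    linarith
  exact ContinuousOn.smul (ContinuousOn.inv₀ (by fun_prop) h0) (by fun_prop)

lemma measurable_dMap {n : ℕ} (ξ : Eu n) : Measurable (dMap ξ) := by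
  unfold dMap
  have h : Measurable fun x : Eu n => (⟪ξ, x⟫ : ℝ) := by fun_prop
  fun_prop

lemma measurable_Refl {n : ℕ} (p : Eu n) : Measurable (Refl p) := by
  unfold Refl
  fun_prop

lemma measurable_tauMap {n : ℕ} (r : ℝ) (p : Eu n) : Measurable (tauMap r p) :=
  (measurable_dMap _).comp ((measurable_Refl p).comp (measurable_dMap _))

lemma norm_smul_lt_one {n : ℕ} {r : ℝ} (hr : r ∈ Ioo (-1 : ℝ) 1) {p : Eu n} (hp : p ∈ sphSet n) :
    ‖r • p‖ < 1 := by
  rw [norm_smul, mem_sphSet.1 hp, mul_one, Real.norm_eq_abs]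
  exact abs_lt.2 hr

lemma tauMap_mem {n : ℕ} {r : ℝ} (hr : r ∈ Ioo (-1 : ℝ) 1) {p : Eu n} (hp : p ∈ sphSet n)
    {x : Eu n} (hx : x ∈ sphSet n) : tauMap r p x ∈ sphSet n :=
  dMap_mem (norm_smul_lt_one hr hp) (Refl_mem hp
    (dMap_mem (by rw [norm_neg]; exact norm_smul_lt_one hr hp) hx))

lemma dMap_neg_tauMap {n : ℕ} {r : ℝ} (hr : r ∈ Ioo (-1 : ℝ) 1) {p : Eu n} (hp : p ∈ sphSet n)
    {x : Eu n} (hx : x ∈ sphSet n) :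
    dMap (-(r • p)) (tauMap r p x) = Refl p (dMap (-(r • p)) x) :=
  dMap_neg_dMap (norm_smul_lt_one hr hp) (Refl_mem hp
    (dMap_mem (by rw [norm_neg]; exact norm_smul_lt_one hr hp) hx))

lemma tauMap_tauMap {n : ℕ} {r : ℝ} (hr : r ∈ Ioo (-1 : ℝ) 1) {p : Eu n} (hp : p ∈ sphSet n)
    {x : Eu n} (hx : x ∈ sphSet n) : tauMap r p (tauMap r p x) = x := by
  change dMap (r • p) (Refl p (dMap (-(r • p)) (tauMap r p x))) = x
  rw [dMap_neg_tauMap hr hp hx, Refl_Refl (mem_sphSet.1 hp),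
    dMap_dMap_neg (norm_smul_lt_one hr hp) hx]

lemma tauMap_neg_neg {n : ℕ} (r : ℝ) (p : Eu n) : tauMap (-r) (-p) = tauMap r p := by
  have : Refl (-p) = Refl p := funext (Refl_neg_left p)
  simp only [tauMap, neg_smul_neg, this]

lemma cap_eq {n : ℕ} {r : ℝ} (hr : r ∈ Ioo (-1 : ℝ) 1) {p : Eu n} (hp : p ∈ sphSet n) :
    cap n r p = sphSet n ∩ {x | 0 < ⟪p, dMap (-(r • p)) x⟫} := by
  have h := norm_smul_lt_one hr hp
  ext x
  constructor
  · rintro ⟨y, ⟨hy, hpy⟩, rfl⟩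
    refine ⟨dMap_mem h hy, ?_⟩
    simpa [dMap_neg_dMap h hy] using hpy
  · rintro ⟨hx, hpx⟩
    exact ⟨_, ⟨dMap_mem (by rwa [norm_neg]) hx, hpx⟩, dMap_dMap_neg h hx⟩

lemma measurableSet_cap {n : ℕ} {r : ℝ} (hr : r ∈ Ioo (-1 : ℝ) 1) {p : Eu n}
    (hp : p ∈ sphSet n) : MeasurableSet (cap n r p) := by
  rw [cap_eq hr hp]
  have h : Measurable fun x : Eu n => (⟪p, dMap (-(r • p)) x⟫ : ℝ) :=
    measurable_const.inner (measurable_dMap _)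
  exact isClosed_sphere.measurableSet.inter (measurableSet_lt measurable_const h)

lemma tauMap_mem_cap_neg_iff {n : ℕ} {r : ℝ} (hr : r ∈ Ioo (-1 : ℝ) 1) {p : Eu n}
    (hp : p ∈ sphSet n) {x : Eu n} (hx : x ∈ sphSet n) :
    tauMap r p x ∈ cap n (-r) (-p) ↔ x ∈ cap n r p := by
  have hr' : -r ∈ Ioo (-1 : ℝ) 1 := ⟨by linarith [hr.2], by linarith [hr.1]⟩
  rw [cap_eq hr hp, cap_eq hr' (neg_mem_sphSet hp)]
  simp only [mem_inter_iff, hx, tauMap_mem hr hp hx, true_and, mem_ofPred_eq, neg_smul_neg,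
    dMap_neg_tauMap hr hp hx, inner_neg_left]
  rw [← inner_neg_left, ← Refl_self (mem_sphSet.1 hp), inner_Refl_Refl (mem_sphSet.1 hp)]

/-! ### Centered measures on the sphere -/

lemma integrable_inner_of_ae_mem {n : ℕ} {ν : Measure (Eu n)} [IsFiniteMeasure ν]
    {f : Eu n → Eu n} (hf : Measurable f) (hS : ∀ᵐ x ∂ν, f x ∈ sphSet n) (s : Eu n) :
    Integrable (fun x => (⟪s, f x⟫ : ℝ)) ν := by
  refine Integrable.of_bound (measurable_const.inner hf).aestronglyMeasurable ‖s‖ ?_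
  filter_upwards [hS] with x hx
  simpa [mem_sphSet.1 hx] using norm_inner_le_norm (𝕜 := ℝ) s (f x)

/-- A conformal transformation of the sphere between two centered measures without atoms is
linear: it has neither translation nor projective part. -/
lemma Represents.eq_zero_of_centered {n : ℕ} {M : Eu n × ℝ →ₗ[ℝ] Eu n × ℝ} {f : Eu n → Eu n}
    (h : Represents M f) (hf : Measurable f) {ν : Measure (Eu n)} [IsFiniteMeasure ν]
    [NullSingletonClass ν]
    (hν : ν ≠ 0) (hS : ∀ᵐ x ∂ν, x ∈ sphSet n)
    (hid : ∀ s : Eu n, ∫ x, (⟪s, x⟫ : ℝ) ∂ν = 0) (hfc : ∀ s : Eu n, ∫ x, (⟪s, f x⟫ : ℝ) ∂ν = 0) :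
    (M (0, 1)).1 = 0 ∧ ∀ x, (M (x, 0)).2 = 0 := by
  obtain ⟨k, hk0, hk⟩ := h.exists_scale
  set b := (M (0, 1)).1 with hb
  set d := (M (0, 1)).2 with hd
  set A : Eu n → Eu n := fun x => (M (x, 0)).1 with hA
  set c : Eu n →ₗ[ℝ] ℝ := LinearMap.snd ℝ (Eu n) ℝ ∘ₗ M ∘ₗ LinearMap.inl ℝ (Eu n) ℝ with hc
  have hM : ∀ x t, M (x, t) = (A x + t • b, c x + t * d) := by
    intro x t
    have h1 : ((x, t) : Eu n × ℝ) = (x, 0) + t • (0, 1) := by simp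
    rw [h1, map_add, map_smul]
    ext1 <;> simp [hA, hc, hb, hd]
  have hq : ∀ x t, ‖A x + t • b‖ ^ 2 - (c x + t * d) ^ 2 = k * (‖x‖ ^ 2 - t ^ 2) := by
    intro x t
    have := hk (x, t)
    rwa [hM] at this
  have hbd : ‖b‖ ^ 2 - d ^ 2 = -k := by
    have h0 : A 0 = 0 := congrArg Prod.fst (map_zero M)
    have := hq 0 1
    simp only [h0, map_zero, zero_add, one_smul, one_mul, norm_zero] at this
    linarith
  have hAx : ∀ x, ‖A x‖ ^ 2 - c x ^ 2 = k * ‖x‖ ^ 2 := fun x => by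
    simpa using hq x 0
  have hAb : ∀ x, (⟪b, A x⟫ : ℝ) = c x * d := by
    intro x
    have h1 := hq x 1
    rw [one_smul, norm_add_sq_real, real_inner_comm] at h1
    linarith [hAx x]
  have hcb : ∀ x, |c x| ≤ ‖b‖ * ‖x‖ := by
    intro x
    have h1 := abs_real_inner_le_norm b (A x)
    rw [hAb] at h1
    have h2 : (c x * d) ^ 2 ≤ (‖b‖ * ‖A x‖) ^ 2 := sq_le_sq' (by linarith [neg_abs_le (c x * d)])
      ((le_abs_self _).trans h1)
    have h3 : k * (c x ^ 2) ≤ k * (‖b‖ * ‖x‖) ^ 2 := by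
      have h4 : d ^ 2 = ‖b‖ ^ 2 + k := by linarith
      have h5 : ‖A x‖ ^ 2 = c x ^ 2 + k * ‖x‖ ^ 2 := by linarith [hAx x]
      rw [mul_pow, mul_pow, h4, h5] at h2
      nlinarith
    exact abs_le_of_sq_le_sq (le_of_mul_le_mul_left h3 hk0) (by positivity)
  have hcx : ∀ x, c x = ⟪(InnerProductSpace.toDual ℝ (Eu n)).symm
      (LinearMap.toContinuousLinearMap c), x⟫ := fun x => by
    rw [InnerProductSpace.toDual_symm_apply]; rfl
  have hfS : ∀ᵐ x ∂ν, f x ∈ sphSet n := hS.mono fun x hx => h.mapsTo hx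
  have hci : Integrable (fun x => c x) ν := by
    simp only [hcx]
    exact integrable_inner_of_ae_mem measurable_id hS _
  have hfi := integrable_inner_of_ae_mem hf hfS b
  have hc0 : ∫ x, c x ∂ν = 0 := by simp only [hcx, hid]
  have hsub : ∫ x, ((⟪b, f x⟫ : ℝ) - c x) ∂ν = 0 := by
    rw [integral_sub hfi hci, hfc, hc0, sub_zero]
  have hkey : ∀ x ∈ sphSet n, 0 < c x + d ∧
      (c x + d) * ((⟪b, f x⟫ : ℝ) - c x) = ‖b‖ ^ 2 - c x ^ 2 := by
    intro x hx
    have h1 := h.pos x hx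
    have h2 := congrArg Prod.fst (h.eq x hx)
    rw [hM] at h1 h2
    simp only [one_smul, one_mul, Prod.smul_fst] at h1 h2
    have h3 := congrArg (fun y => (⟪b, y⟫ : ℝ)) h2
    simp only [inner_add_right, inner_smul_right, hAb, real_inner_self_eq_norm_sq] at h3
    exact ⟨h1, by linarith⟩
  have hnonneg : 0 ≤ᵐ[ν] fun x => (⟪b, f x⟫ : ℝ) - c x := by
    filter_upwards [hS] with x hx
    obtain ⟨h1, h2⟩ := hkey x hx
    have h3 := hcb x
    rw [mem_sphSet.1 hx, mul_one] at h3
    have h4 : c x ^ 2 ≤ ‖b‖ ^ 2 := sq_le_sq.2 (by rwa [abs_norm])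
    exact nonneg_of_mul_nonneg_right (by rw [h2]; linarith) h1
  have hzero := (integral_eq_zero_iff_of_nonneg_ae hnonneg (hfi.sub hci)).1 hsub
  have hcases : ∀ᵐ x ∂ν, x ∈ sphSet n ∧ (c x = ‖b‖ ∨ c x = -‖b‖) := by
    filter_upwards [hS, hzero] with x hx h0
    refine ⟨hx, sq_eq_sq_iff_eq_or_eq_neg.1 ?_⟩
    have h1 := (hkey x hx).2
    have h0' : (⟪b, f x⟫ : ℝ) - c x = 0 := h0
    rw [h0', mul_zero] at h1
    linarith
  have hb0 : b = 0 := by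
    by_contra hb0
    have hbp : 0 < ‖b‖ := norm_pos_iff.2 hb0
    have hsub : ∀ ε : ℝ, |ε| = 1 → {x | x ∈ sphSet n ∧ c x = ε * ‖b‖}.Subsingleton := by
      rintro ε hε x ⟨hx, hcx⟩ y ⟨hy, hcy⟩
      have h1 := hcb (x + y)
      rw [map_add, hcx, hcy, ← add_mul, ← two_mul, abs_mul, abs_mul, hε, abs_norm] at h1
      norm_num at h1
      have h2 : 2 ≤ ‖x + y‖ := by nlinarith
      have h3 := parallelogram_law_with_norm ℝ x y
      rw [mem_sphSet.1 hx, mem_sphSet.1 hy] at h3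
      have h4 : ‖x - y‖ = 0 := by nlinarith [norm_nonneg (x - y)]
      exact sub_eq_zero.1 (norm_eq_zero.1 h4)
    refine hν (Measure.measure_univ_eq_zero.1 ?_)
    refine measure_mono_null (t := {x | x ∈ sphSet n ∧ c x = 1 * ‖b‖} ∪
      {x | x ∈ sphSet n ∧ c x = (-1) * ‖b‖} ∪ {x | ¬ (x ∈ sphSet n ∧ (c x = ‖b‖ ∨ c x = -‖b‖))})
      (fun x _ => ?_) (measure_union_null (measure_union_null
        ((hsub 1 (by norm_num)).measure_zero ν) ((hsub (-1) (by norm_num)).measure_zero ν))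
        (ae_iff.1 hcases))
    by_cases hx : x ∈ sphSet n ∧ (c x = ‖b‖ ∨ c x = -‖b‖)
    · rcases hx with ⟨hx, h | h⟩
      · exact .inl (.inl ⟨hx, by rw [h, one_mul]⟩)
      · exact .inl (.inr ⟨hx, by rw [h, neg_one_mul]⟩)
    · exact .inr hx
  refine ⟨hb0, fun x => ?_⟩
  have := hcb x
  rw [hb0, norm_zero, zero_mul] at this
  exact abs_nonpos_iff.1 this

/-- A conformal transformation without translation and projective part is a linear isometry. -/
lemma Represents.exists_linearIsometryEquiv {n : ℕ} {M : Eu n × ℝ →ₗ[ℝ] Eu n × ℝ}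
    {f : Eu n → Eu n} (h : Represents M f) (hb : (M (0, 1)).1 = 0) (hc : ∀ x, (M (x, 0)).2 = 0) :
    ∃ L : Eu n ≃ₗᵢ[ℝ] Eu n, ∀ x ∈ sphSet n, f x = L x := by
  obtain ⟨k, hk0, hk⟩ := h.exists_scale
  set d := (M (0, 1)).2 with hd
  have hM : ∀ x, M (x, 1) = ((M (x, 0)).1, d) := by
    intro x
    have h1 : ((x, 1) : Eu n × ℝ) = (x, 0) + (0, 1) := by simp
    rw [h1, map_add]
    ext1
    · simp [hb]
    · simp [hc, hd]
  have hd0 : 0 < d := by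
    have := h.pos (EuclideanSpace.single 0 1) (by simp [mem_sphSet])
    rwa [hM] at this
  have hkd : k = d ^ 2 := by
    have := hk (0, 1)
    simp only [lorentzForm, hb, norm_zero] at this
    rw [← hd] at this
    linarith
  set A : Eu n →ₗ[ℝ] Eu n :=
    d⁻¹ • (LinearMap.fst ℝ (Eu n) ℝ ∘ₗ M ∘ₗ LinearMap.inl ℝ (Eu n) ℝ) with hA
  have hAx : ∀ x, A x = d⁻¹ • (M (x, 0)).1 := fun x => rfl
  have hAn : ∀ x, ‖A x‖ = ‖x‖ := by
    intro x
    have h1 := hk (x, 0)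
    simp only [lorentzForm, hc, hkd] at h1
    have h2 : ‖(M (x, 0)).1‖ = d * ‖x‖ := by
      rw [← sq_eq_sq₀ (norm_nonneg _) (by positivity)]
      linarith
    rw [hAx, norm_smul, h2, norm_inv, Real.norm_of_nonneg hd0.le, inv_mul_cancel_left₀ hd0.ne']
  refine ⟨LinearIsometry.toLinearIsometryEquiv ⟨A, hAn⟩ rfl, fun x hx => ?_⟩
  have h1 := congrArg Prod.fst (h.eq x hx)
  rw [hM] at h1
  simp only [Prod.smul_fst] at h1
  change f x = A x
  rw [hAx, h1, smul_smul, inv_mul_cancel₀ hd0.ne', one_smul]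

/-! ### Maximal directions under linear isometries -/

lemma Qform_map {n : ℕ} (ν : Measure (Eu n)) (L : Eu n ≃ₗᵢ[ℝ] Eu n) (s : Eu n) :
    Qform (ν.map L) (L s) = Qform ν s := by
  have h : MeasurableEmbedding L := L.toHomeomorph.measurableEmbedding
  unfold Qform
  rw [h.integral_map]
  simp

lemma maxEig_map {n : ℕ} (ν : Measure (Eu n)) (L : Eu n ≃ₗᵢ[ℝ] Eu n) :
    maxEig n (ν.map L) = maxEig n ν := by
  unfold maxEig
  congr 1
  ext q
  constructor
  · rintro ⟨s, hs, rfl⟩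
    exact ⟨L.symm s, by simpa using hs, by rw [← Qform_map ν L, L.apply_symm_apply]⟩
  · rintro ⟨s, hs, rfl⟩
    exact ⟨L s, by simpa using hs, (Qform_map ν L s).symm⟩

lemma IsMaxDir.map {n : ℕ} {ν : Measure (Eu n)} {s : Eu n} (h : IsMaxDir ν s)
    (L : Eu n ≃ₗᵢ[ℝ] Eu n) : IsMaxDir (ν.map L) (L s) := by
  refine ⟨by simpa using h.1, fun t => ?_⟩
  obtain ⟨t, rfl⟩ := L.surjective t
  rw [Qform_map, maxEig_map, L.norm_map, h.2]
  simp only [← map_smul, L.injective.eq_iff]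

lemma IsMaxDir.eq_or_eq_neg {n : ℕ} {ν : Measure (Eu n)} {s t : Eu n} (hs : IsMaxDir ν s)
    (ht : IsMaxDir ν t) : t = s ∨ t = -s := by
  obtain ⟨c, hc⟩ := (hs.2 t).1 ((ht.2 t).2 ⟨1, (one_smul _ _).symm⟩)
  have h1 := ht.1
  rw [hc, norm_smul, hs.1, mul_one, Real.norm_eq_abs] at h1
  rcases eq_or_eq_neg_of_abs_eq h1 with h | h
  · left; rw [hc, h, one_smul]
  · right; rw [hc, h, neg_one_smul]

lemma IsMaxDir.ne_zero {n : ℕ} (hn : 1 ≤ n) {ν : Measure (Eu n)} {s : Eu n}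
    (hs : IsMaxDir ν s) : ν ≠ 0 := by
  rintro rfl
  have h0 : ∀ t : Eu n, Qform (0 : Measure (Eu n)) t = 0 := fun t => by simp [Qform]
  have h1 := (hs.2 s).2 ⟨1, (one_smul _ _).symm⟩
  rw [h0, hs.1, one_pow, mul_one] at h1
  have h2 : ∀ t : Eu n, ∃ c : ℝ, t = c • s := fun t => (hs.2 t).1 (by rw [h0, ← h1, zero_mul])
  obtain ⟨c, hc⟩ := h2 (EuclideanSpace.single 0 1)
  obtain ⟨c', hc'⟩ := h2 (EuclideanSpace.single (Fin.last n) 1)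
  have hne : (0 : Fin (n + 1)) ≠ Fin.last n := by
    intro h
    have := congrArg Fin.val h
    simp at this
    omega
  have e1 : 1 = c * s 0 := by simpa using congrArg (fun x : Eu n => x 0) hc
  have e2 : 0 = c * s (Fin.last n) := by
    simpa [hne.symm] using congrArg (fun x : Eu n => x (Fin.last n)) hc
  have e3 : 1 = c' * s (Fin.last n) := by
    simpa using congrArg (fun x : Eu n => x (Fin.last n)) hc'
  rcases mul_eq_zero.1 e2.symm with h | h
  · rw [h, zero_mul] at e1; exact one_ne_zero e1
  · rw [h, mul_zero] at e3; exact one_ne_zero e3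

/-! ### The measures on the sphere and its caps -/

lemma ae_mem_sphSet_confMeasure (n : ℕ) (w : Eu n → ℝ) :
    ∀ᵐ x ∂(confMeasure n w), x ∈ sphSet n := by
  refine (withDensity_absolutelyContinuous _ _).ae_le ?_
  refine (ae_map_iff measurable_subtype_coe.aemeasurable isClosed_sphere.measurableSet).2 ?_
  exact Eventually.of_forall fun x => x.2

lemma nullSingletonClass_confMeasure {n : ℕ} (hn : 1 ≤ n) (w : Eu n → ℝ) :
    NullSingletonClass (confMeasure n w) := by
  refine ⟨fun x => withDensity_absolutelyContinuous _ _ ?_⟩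
  unfold sphMeasure
  rw [Measure.map_apply measurable_subtype_coe (measurableSet_singleton x),
    Measure.toSphere_apply' _ (measurable_subtype_coe (measurableSet_singleton x))]
  refine mul_eq_zero_of_right _ (measure_mono_null (t := (Submodule.span ℝ {x} : Set (Eu n))) ?_
    (Measure.addHaar_submodule volume _ ?_))
  · rintro _ ⟨t, -, _, ⟨y, hy, rfl⟩, rfl⟩
    have hy' : (y : Eu n) = x := hy
    rw [hy']
    exact Submodule.smul_mem _ _ (Submodule.mem_span_singleton_self x)
  · intro h
    have h1 := finrank_span_le_card (R := ℝ) ({x} : Set (Eu n))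
    rw [h, finrank_top] at h1
    simp at h1
    omega

lemma MeasureTheory.NullSingletonClass.map_of_injOn {n : ℕ} {μ : Measure (Eu n)}
    (hμ : NullSingletonClass μ)
    {f : Eu n → Eu n} (hf : Measurable f) {S : Set (Eu n)} (hS : ∀ᵐ x ∂μ, x ∈ S)
    (hinj : InjOn f S) : NullSingletonClass (μ.map f) := by
  refine ⟨fun y => ?_⟩
  rw [Measure.map_apply hf (measurableSet_singleton y)]
  have hsub : (f ⁻¹' {y} ∩ S).Subsingleton := fun a ha b hb =>
    hinj ha.2 hb.2 (ha.1.trans hb.1.symm)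
  refine measure_mono_null (t := (f ⁻¹' {y} ∩ S) ∪ Sᶜ) (fun x hx => ?_)
    (measure_union_null (hsub.measure_zero μ) (mem_ae_iff.1 hS))
  by_cases h : x ∈ S
  · exact .inl ⟨hx, h⟩
  · exact .inr h

lemma ae_mem_map {n : ℕ} {μ : Measure (Eu n)} (hS : ∀ᵐ x ∂μ, x ∈ sphSet n) {f : Eu n → Eu n}
    (hf : Measurable f) (hfS : MapsTo f (sphSet n) (sphSet n)) :
    ∀ᵐ x ∂(μ.map f), x ∈ sphSet n :=
  (ae_map_iff hf.aemeasurable isClosed_sphere.measurableSet).2 (hS.mono fun _ hx => hfS hx)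

lemma ae_mem_sphSet_add_map {n : ℕ} (w : Eu n → ℝ) {r : ℝ} (hr : r ∈ Ioo (-1 : ℝ) 1) {p : Eu n}
    (hp : p ∈ sphSet n) :
    ∀ᵐ x ∂(confMeasure n w + (confMeasure n w).map (tauMap r p)), x ∈ sphSet n :=
  ae_add_measure_iff.2 ⟨ae_mem_sphSet_confMeasure n w, ae_mem_map (ae_mem_sphSet_confMeasure n w)
    (measurable_tauMap r p) fun _ hx => tauMap_mem hr hp hx⟩

lemma ae_mem_sphSet_capMeasure {n : ℕ} (w : Eu n → ℝ) {r : ℝ} (hr : r ∈ Ioo (-1 : ℝ) 1)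
    {p : Eu n} (hp : p ∈ sphSet n) : ∀ᵐ x ∂(capMeasure n w r p), x ∈ sphSet n :=
  ae_restrict_of_ae (ae_mem_sphSet_add_map w hr hp)

lemma nullSingletonClass_capMeasure {n : ℕ} (hn : 1 ≤ n) (w : Eu n → ℝ) {r : ℝ}
    (hr : r ∈ Ioo (-1 : ℝ) 1) {p : Eu n} (hp : p ∈ sphSet n) :
    NullSingletonClass (capMeasure n w r p) := by
  have h1 := nullSingletonClass_confMeasure hn w
  have h2 := h1.map_of_injOn (measurable_tauMap r p) (ae_mem_sphSet_confMeasure n w)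
    (LeftInvOn.injOn fun _ hx => tauMap_tauMap hr hp hx)
  refine ⟨fun x => ?_⟩
  refine measure_mono_null subset_rfl
    (Measure.absolutelyContinuous_of_le Measure.restrict_le_self ?_)
  rw [Measure.add_apply, h1.measure_singleton, h2.measure_singleton, add_zero]

lemma isFiniteMeasure_capMeasure {n : ℕ} {w : Eu n → ℝ} (hvol : confMeasure n w univ = 1)
    (r : ℝ) (p : Eu n) : IsFiniteMeasure (capMeasure n w r p) := by
  have : IsFiniteMeasure (confMeasure n w) := ⟨by rw [hvol]; exact ENNReal.one_lt_top⟩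
  unfold capMeasure
  infer_instance

lemma neg_mem_Ioo {r : ℝ} (hr : r ∈ Ioo (-1 : ℝ) 1) : -r ∈ Ioo (-1 : ℝ) 1 :=
  ⟨by linarith [hr.2], by linarith [hr.1]⟩

lemma map_tauMap_capMeasure {n : ℕ} (w : Eu n → ℝ) {r : ℝ} (hr : r ∈ Ioo (-1 : ℝ) 1) {p : Eu n}
    (hp : p ∈ sphSet n) :
    (capMeasure n w r p).map (tauMap r p) = capMeasure n w (-r) (-p) := by
  have hτ := measurable_tauMap r p
  have h1 : (tauMap r p ⁻¹' cap n (-r) (-p)) =ᵐ[confMeasure n w +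
      (confMeasure n w).map (tauMap r p)] cap n r p := by
    filter_upwards [ae_mem_sphSet_add_map w hr hp] with x hx
    exact propext (tauMap_mem_cap_neg_iff hr hp hx)
  have h2 : ((confMeasure n w).map (tauMap r p)).map (tauMap r p) = confMeasure n w := by
    rw [Measure.map_map hτ hτ]
    conv_rhs => rw [← Measure.map_id (μ := confMeasure n w)]
    refine Measure.map_congr ?_
    filter_upwards [ae_mem_sphSet_confMeasure n w] with x hx
    exact tauMap_tauMap hr hp hx
  unfold capMeasure
  rw [← Measure.restrict_congr_set h1, ← Measure.restrict_map hτ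
    (measurableSet_cap (neg_mem_Ioo hr) (neg_mem_sphSet hp)), Measure.map_add _ _ hτ, h2,
    tauMap_neg_neg]
  exact congrArg (fun m : Measure (Eu n) => m.restrict (cap n (-r) (-p))) (add_comm _ _)

lemma Renormalizes.integral_inner_map {n : ℕ} {ξ : Eu n} {μ : Measure (Eu n)}
    (h : Renormalizes ξ μ) (s : Eu n) : ∫ x, (⟪s, x⟫ : ℝ) ∂(μ.map (dMap ξ)) = 0 := by
  have hs : AEStronglyMeasurable (fun x : Eu n => (⟪s, x⟫ : ℝ)) (μ.map (dMap ξ)) :=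
    (measurable_const.inner measurable_id).aestronglyMeasurable
  rw [integral_map (measurable_dMap ξ).aemeasurable hs]
  by_cases h0 : s = 0
  · simp [h0]
  · have h1 := h _ (normalize_mem_sphSet h0)
    simp only [Xfun, inner_smul_left, integral_const_mul] at h1
    refine (mul_eq_zero.1 h1).resolve_left ?_
    simpa using h0

/-- The transformation `d_{ξ'} ∘ τ ∘ d_{-ξ}` between renormalized caps. -/
def capTransform {n : ℕ} (r : ℝ) (p ξ ξ' : Eu n) : Eu n → Eu n :=
  dMap ξ' ∘ tauMap r p ∘ dMap (-ξ)

/-- The linear map inducing `capTransform`. -/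
def capLin {n : ℕ} (r : ℝ) (p ξ ξ' : Eu n) : Eu n × ℝ →ₗ[ℝ] Eu n × ℝ :=
  dLin ξ' ∘ₗ (dLin (r • p) ∘ₗ reflLin p ∘ₗ dLin (-(r • p))) ∘ₗ dLin (-ξ)

lemma represents_capTransform {n : ℕ} {r : ℝ} (hr : r ∈ Ioo (-1 : ℝ) 1) {p : Eu n}
    (hp : p ∈ sphSet n) {ξ ξ' : Eu n} (hξ : ‖ξ‖ < 1) (hξ' : ‖ξ'‖ < 1) :
    Represents (capLin r p ξ ξ') (capTransform r p ξ ξ') := by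
  have h := norm_smul_lt_one hr hp
  exact (represents_dMap hξ').comp (((represents_dMap h).comp ((represents_Refl
    (mem_sphSet.1 hp)).comp (represents_dMap (by rwa [norm_neg])))).comp
    (represents_dMap (by rwa [norm_neg])))

/-- The transformation between two complementary renormalized caps is linear and it preserves
maximal directions. -/
lemma capTransform_isMaxDir {n : ℕ} (hn : 1 ≤ n) {w : Eu n → ℝ}
    (hvol : confMeasure n w univ = 1) {r : ℝ} (hr : r ∈ Ioo (-1 : ℝ) 1) {p : Eu n}
    (hp : p ∈ sphSet n) {ξ ξ' s s' : Eu n} (hξ : ‖ξ‖ < 1) (hξ' : ‖ξ'‖ < 1)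
    (hR : Renormalizes ξ (capMeasure n w r p))
    (hR' : Renormalizes ξ' (capMeasure n w (-r) (-p)))
    (hs : IsMaxDir ((capMeasure n w r p).map (dMap ξ)) s)
    (hs' : IsMaxDir ((capMeasure n w (-r) (-p)).map (dMap ξ')) s') :
    (capLin r p ξ ξ' (0, 1)).1 = 0 ∧
      (s' = capTransform r p ξ ξ' s ∨ s' = -capTransform r p ξ ξ' s) := by
  set f := capTransform r p ξ ξ' with hf
  set μ := capMeasure n w r p with hμ
  set ν := μ.map (dMap ξ) with hν
  have hrep : Represents (capLin r p ξ ξ') f := represents_capTransform hr hp hξ hξ'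
  have hfm : Measurable f :=
    (measurable_dMap _).comp ((measurable_tauMap r p).comp (measurable_dMap _))
  have hμS := ae_mem_sphSet_capMeasure w hr hp
  have hνS : ∀ᵐ x ∂ν, x ∈ sphSet n :=
    ae_mem_map hμS (measurable_dMap ξ) fun _ hx => dMap_mem hξ hx
  have : IsFiniteMeasure μ := isFiniteMeasure_capMeasure hvol r p
  have : NullSingletonClass ν := (nullSingletonClass_capMeasure hn w hr hp).map_of_injOn
    (measurable_dMap ξ) hμS (LeftInvOn.injOn fun _ hx => dMap_neg_dMap hξ hx)
  have hν' : (capMeasure n w (-r) (-p)).map (dMap ξ') = ν.map f := by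
    rw [← map_tauMap_capMeasure w hr hp, Measure.map_map (measurable_dMap ξ')
      (measurable_tauMap r p), Measure.map_map hfm (measurable_dMap ξ)]
    refine Measure.map_congr ?_
    filter_upwards [hμS] with x hx
    simp only [hf, capTransform, Function.comp_apply, dMap_neg_dMap hξ hx]
  have hfc : ∀ t : Eu n, ∫ x, (⟪t, f x⟫ : ℝ) ∂ν = 0 := by
    intro t
    have ht : AEStronglyMeasurable (fun x : Eu n => (⟪t, x⟫ : ℝ)) (ν.map f) :=
      (measurable_const.inner measurable_id).aestronglyMeasurable
    rw [← integral_map hfm.aemeasurable ht, ← hν']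
    exact hR'.integral_inner_map t
  obtain ⟨hb, hc⟩ := hrep.eq_zero_of_centered hfm (hs.ne_zero hn) hνS hR.integral_inner_map hfc
  obtain ⟨L, hL⟩ := hrep.exists_linearIsometryEquiv hb hc
  refine ⟨hb, ?_⟩
  have hνL : ν.map f = ν.map L := Measure.map_congr (hνS.mono fun x hx => hL x hx)
  rw [hν', hνL] at hs'
  rw [hL s (mem_sphSet.2 hs.1)]
  exact (hs.map L).eq_or_eq_neg hs'

/-- For hemispheres the linearity of the transformation determines the renormalization point of
the complementary cap. -/
lemma Refl_eq_of_capLin_eq_zero {n : ℕ} {p : Eu n} (hp : ‖p‖ = 1) {ξ ξ' : Eu n}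
    (hξ : ‖ξ‖ < 1) (hξ' : ‖ξ'‖ < 1) (h : (capLin 0 p ξ ξ' (0, 1)).1 = 0) : Refl p ξ = ξ' := by
  set η := Refl p ξ with hη
  have hηn : ‖η‖ = ‖ξ‖ := norm_Refl hp ξ
  have h1 : (1 - ‖ξ'‖ ^ 2) • η = (1 + ‖η‖ ^ 2 - 2 * ⟪ξ', η⟫) • ξ' := by
    simp [capLin, dLin, reflLin, Refl_smul, Refl_neg_right, inner_smul_right] at h
    rw [← hη, ← hηn] at h
    have h2 : (2 : ℝ) • ((1 - ‖ξ'‖ ^ 2) • η - (1 + ‖η‖ ^ 2 - 2 * ⟪ξ', η⟫) • ξ') = 0 := by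
      rw [← neg_eq_zero, ← h]
      module
    exact sub_eq_zero.1 ((smul_eq_zero.1 h2).resolve_left two_ne_zero)
  rw [← hηn] at hξ
  have h0 : 0 < 1 - ‖ξ'‖ ^ 2 := by nlinarith [norm_nonneg ξ']
  obtain ⟨l, hl⟩ : ∃ l : ℝ, η = l • ξ' := ⟨(1 - ‖ξ'‖ ^ 2)⁻¹ * (1 + ‖η‖ ^ 2 - 2 * ⟪ξ', η⟫), by
    rw [mul_smul, ← h1, smul_smul, inv_mul_cancel₀ h0.ne', one_smul]⟩
  by_cases hz : ξ' = 0
  · rw [hl, hz, smul_zero]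
  have hn2 : ‖η‖ ^ 2 = l ^ 2 * ‖ξ'‖ ^ 2 := by
    rw [hl, norm_smul, mul_pow, Real.norm_eq_abs, sq_abs]
  have hin : (⟪ξ', η⟫ : ℝ) = l * ‖ξ'‖ ^ 2 := by
    rw [hl, inner_smul_right, real_inner_self_eq_norm_sq]
  rw [hn2, hin, hl, smul_smul] at h1
  have h2 := smul_left_injective ℝ hz h1
  have h3 : (l * ‖ξ'‖ ^ 2 - 1) * (l - 1) = 0 := by linarith
  rcases mul_eq_zero.1 h3 with h4 | h4
  · exfalso
    have h5 : ‖η‖ ^ 2 * ‖ξ'‖ ^ 2 = 1 := by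
      rw [hn2]
      have : l * ‖ξ'‖ ^ 2 = 1 := by linarith
      linear_combination (l * ‖ξ'‖ ^ 2 + 1) * this
    have h6 : ‖η‖ ^ 2 < 1 := by nlinarith [norm_nonneg η]
    nlinarith [sq_nonneg ‖η‖, sq_nonneg ‖ξ'‖]
  · rw [hl, show l = 1 by linarith, one_smul]

lemma capTransform_zero {n : ℕ} {p ξ ξ' : Eu n} (hp : ‖p‖ = 1) (hξ : ‖ξ‖ < 1)
    (h : Refl p ξ = ξ') {x : Eu n} (hx : x ∈ sphSet n) : capTransform 0 p ξ ξ' x = Refl p x := by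
  simp only [capTransform, tauMap, Function.comp_apply, zero_smul, neg_zero, dMap_zero]
  rw [← h, dMap_Refl_Refl hp, dMap_dMap_neg hξ hx]

lemma ContinuousOn.capTransform {n : ℕ} {X : Type*} [TopologicalSpace X] {D : Set X} {r : X → ℝ}
    {p ξ ξ' y : X → Eu n} (hr : ContinuousOn r D) (hp : ContinuousOn p D)
    (hξ : ContinuousOn ξ D) (hξ' : ContinuousOn ξ' D) (hy : ContinuousOn y D)
    (hrD : ∀ q ∈ D, r q ∈ Ioo (-1 : ℝ) 1) (hpD : ∀ q ∈ D, p q ∈ sphSet n)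
    (hξD : ∀ q ∈ D, ‖ξ q‖ < 1) (hξD' : ∀ q ∈ D, ‖ξ' q‖ < 1) (hyD : ∀ q ∈ D, y q ∈ sphSet n) :
    ContinuousOn (fun q => _root_.capTransform (r q) (p q) (ξ q) (ξ' q) (y q)) D := by
  have h1 : ∀ q ∈ D, ‖r q • p q‖ < 1 := fun q hq => norm_smul_lt_one (hrD q hq) (hpD q hq)
  have h2 : ∀ q ∈ D, ‖-(r q • p q)‖ < 1 := fun q hq => by rw [norm_neg]; exact h1 q hq
  have h3 : ∀ q ∈ D, ‖-ξ q‖ < 1 := fun q hq => by rw [norm_neg]; exact hξD q hq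
  have hm1 : ∀ q ∈ D, _root_.dMap (-ξ q) (y q) ∈ sphSet n := fun q hq =>
    dMap_mem (h3 q hq) (hyD q hq)
  have hm2 : ∀ q ∈ D, Refl (p q) (_root_.dMap (-(r q • p q)) (_root_.dMap (-ξ q) (y q))) ∈
      sphSet n := fun q hq => Refl_mem (hpD q hq) (dMap_mem (h2 q hq) (hm1 q hq))
  have hc : ContinuousOn (fun q => r q • p q) D := hr.smul hp
  have hc1 : ContinuousOn (fun q => _root_.dMap (-ξ q) (y q)) D :=
    ContinuousOn.dMap (ξ := fun q => -ξ q) hξ.neg hy h3 hyD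
  have hc2 : ContinuousOn (fun q => _root_.dMap (-(r q • p q)) (_root_.dMap (-ξ q) (y q))) D :=
    ContinuousOn.dMap (ξ := fun q => -(r q • p q)) hc.neg hc1 h2 hm1
  have hin : ContinuousOn (fun q => (⟪p q, _root_.dMap (-(r q • p q))
    (_root_.dMap (-ξ q) (y q))⟫ : ℝ)) D := hp.inner hc2
  have hc3 : ContinuousOn (fun q => Refl (p q) (_root_.dMap (-(r q • p q))
      (_root_.dMap (-ξ q) (y q)))) D :=
    hc2.sub ((continuousOn_const.mul hin).smul hp)
  exact ContinuousOn.dMap hξ' (ContinuousOn.dMap hc hc3 h1 hm2) hξD'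
    fun q hq => dMap_mem (h1 q hq) (hm2 q hq)

/-- Continuous unit vector fields that agree up to sign on a preconnected set agree up to a
constant sign. -/
lemma IsPreconnected.eq_or_eq_neg_of_norm_eq_one {X E : Type*} [TopologicalSpace X]
    [NormedAddCommGroup E] [InnerProductSpace ℝ E] {D : Set X} (hD : IsPreconnected D)
    {u v : X → E} (hu : ContinuousOn u D) (hv : ContinuousOn v D) (hu1 : ∀ q ∈ D, ‖u q‖ = 1)
    (h : ∀ q ∈ D, u q = v q ∨ u q = -v q) :
    (∀ q ∈ D, u q = v q) ∨ ∀ q ∈ D, u q = -v q := by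
  have hc : ContinuousOn (fun q => (⟪u q, v q⟫ : ℝ)) D := hu.inner hv
  have h1 : ∀ q ∈ D, u q = v q → (⟪u q, v q⟫ : ℝ) = 1 := fun q hq hq' => by
    rw [← hq', real_inner_self_eq_norm_sq, hu1 q hq, one_pow]
  have h2 : ∀ q ∈ D, u q = -v q → (⟪u q, v q⟫ : ℝ) = -1 := fun q hq hq' => by
    rw [← neg_eq_iff_eq_neg.2 hq', inner_neg_right, real_inner_self_eq_norm_sq, hu1 q hq, one_pow]
  by_contra! hcon
  obtain ⟨⟨a, ha, ha'⟩, b, hb, hb'⟩ := hcon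
  have ha2 := h2 a ha ((h a ha).resolve_left ha')
  have hb2 := h1 b hb ((h b hb).resolve_right hb')
  obtain ⟨c, hcD, hc0⟩ := hD.intermediate_value ha hb hc
    (show (0 : ℝ) ∈ Icc (⟪u a, v a⟫ : ℝ) ⟪u b, v b⟫ by rw [ha2, hb2]; norm_num)
  dsimp only at hc0
  rcases h c hcD with h3 | h3
  · linarith [h1 c hcD h3]
  · linarith [h2 c hcD h3]

lemma isPreconnected_sphSet {n : ℕ} (hn : 1 ≤ n) : IsPreconnected (sphSet n) := by
  have h : 1 < Module.rank ℝ (Eu n) := by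
    rw [← Module.finrank_eq_rank, finrank_euclideanSpace_fin]
    exact_mod_cast (by omega : 1 < n + 1)
  exact isPreconnected_sphere h 0 1

/-- Assume all the measures `dv_g` and `ν_a` are simple, and let `s` be the
continuous lift to `S^n` of the maximal-direction map `(r,p) ↦ [s(a_{r,p})] ∈ ℝP^n` with
`s(-1,·) = -e₁`. Then `s(a*) = -R_a s(a)` for every cap `a`, where
`R_a = d_{ξ(a*)} ∘ τ_a ∘ d_{-ξ(a)}`. -/
theorem lift_of_maximal_direction_antisymmetric (n : ℕ) (hn : 2 ≤ n)
    (w : Eu n → ℝ) (hw : IsConformalFactor n w) (hvol : confMeasure n w Set.univ = 1)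
    (hmean : ∀ t : Eu n, ∫ x, (⟪t, x⟫ : ℝ) ∂(confMeasure n w) = 0)
    (hsimple : IsMaxDir (confMeasure n w) (e1 n))
    (ξfun : ℝ → Eu n → Eu n) (sfun : ℝ → Eu n → Eu n)
    (hξ : ∀ r ∈ Set.Ioo (-1 : ℝ) 1, ∀ p ∈ sphSet n,
      ‖ξfun r p‖ < 1 ∧ Renormalizes (ξfun r p) (capMeasure n w r p))
    (hξcont : ContinuousOn (fun q : ℝ × Eu n => ξfun q.1 q.2)
      (Set.Ioo (-1 : ℝ) 1 ×ˢ sphSet n))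
    (hmax : ∀ r ∈ Set.Ioo (-1 : ℝ) 1, ∀ p ∈ sphSet n,
      IsMaxDir (Measure.map (dMap (ξfun r p)) (capMeasure n w r p)) (sfun r p))
    (hscont : ContinuousOn (fun q : ℝ × Eu n => sfun q.1 q.2)
      (Set.Ico (-1 : ℝ) 1 ×ˢ sphSet n))
    (hinit : ∀ p ∈ sphSet n, sfun (-1) p = -(e1 n)) :
    ∀ r ∈ Set.Ioo (-1 : ℝ) 1, ∀ p ∈ sphSet n,
      sfun (-r) (-p) =
        -(dMap (ξfun (-r) (-p)) (tauMap r p (dMap (-(ξfun r p)) (sfun r p)))) := by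
  have hkey : ∀ r ∈ Ioo (-1 : ℝ) 1, ∀ p ∈ sphSet n,
      (capLin r p (ξfun r p) (ξfun (-r) (-p)) (0, 1)).1 = 0 ∧
      (sfun (-r) (-p) = capTransform r p (ξfun r p) (ξfun (-r) (-p)) (sfun r p) ∨
        sfun (-r) (-p) = -capTransform r p (ξfun r p) (ξfun (-r) (-p)) (sfun r p)) := by
    intro r hr p hp
    have hr' := neg_mem_Ioo hr
    have hp' := neg_mem_sphSet hp
    exact capTransform_isMaxDir (by omega) hvol hr hp (hξ r hr p hp).1 (hξ _ hr' _ hp').1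
      (hξ r hr p hp).2 (hξ _ hr' _ hp').2 (hmax r hr p hp) (hmax _ hr' _ hp')
  have hsS : ∀ r ∈ Ioo (-1 : ℝ) 1, ∀ p ∈ sphSet n, sfun r p ∈ sphSet n := fun r hr p hp =>
    mem_sphSet.2 (hmax r hr p hp).1
  set D : Set (ℝ × Eu n) := Ioo (-1 : ℝ) 1 ×ˢ sphSet n with hD
  have hnegD : MapsTo (fun q : ℝ × Eu n => (-q.1, -q.2)) D D := fun q hq =>
    ⟨neg_mem_Ioo hq.1, neg_mem_sphSet hq.2⟩
  have hneg : ContinuousOn (fun q : ℝ × Eu n => (-q.1, -q.2)) D := by fun_prop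
  have hsD : ContinuousOn (fun q : ℝ × Eu n => sfun q.1 q.2) D :=
    hscont.mono (prod_mono Ioo_subset_Ico_self subset_rfl)
  have hDc : IsPreconnected D := by
    exact isPreconnected_Ioo.prod (isPreconnected_sphSet (by omega))
  have hu : ContinuousOn (fun q : ℝ × Eu n => sfun (-q.1) (-q.2)) D := by
    exact hsD.comp hneg hnegD
  have hξn : ContinuousOn (fun q : ℝ × Eu n => ξfun (-q.1) (-q.2)) D := by
    exact hξcont.comp hneg hnegD
  have hξ1 : ∀ q ∈ D, ‖ξfun q.1 q.2‖ < 1 := fun q hq => (hξ _ hq.1 _ hq.2).1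
  have hs1 : ∀ q ∈ D, sfun q.1 q.2 ∈ sphSet n := fun q hq => hsS _ hq.1 _ hq.2
  have hξn1 : ∀ q ∈ D, ‖ξfun (-q.1) (-q.2)‖ < 1 := fun q hq => hξ1 (-q.1, -q.2) (hnegD hq)
  have hv : ContinuousOn (fun q : ℝ × Eu n => capTransform q.1 q.2 (ξfun q.1 q.2)
      (ξfun (-q.1) (-q.2)) (sfun q.1 q.2)) D := by
    exact ContinuousOn.capTransform continuousOn_fst continuousOn_snd hξcont hξn hsD
      (fun q hq => hq.1) (fun q hq => hq.2) hξ1 hξn1 hs1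
  have hu1 : ∀ q ∈ D, ‖sfun (-q.1) (-q.2)‖ = 1 := fun q hq =>
    mem_sphSet.1 (hs1 (-q.1, -q.2) (hnegD hq))
  have hpm : ∀ q ∈ D, sfun (-q.1) (-q.2) =
      capTransform q.1 q.2 (ξfun q.1 q.2) (ξfun (-q.1) (-q.2)) (sfun q.1 q.2) ∨
      sfun (-q.1) (-q.2) =
      -capTransform q.1 q.2 (ξfun q.1 q.2) (ξfun (-q.1) (-q.2)) (sfun q.1 q.2) := fun q hq => by
    exact (hkey q.1 (mem_prod.1 hq).1 q.2 (mem_prod.1 hq).2).2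
  have hsign := hDc.eq_or_eq_neg_of_norm_eq_one hu hv hu1 hpm
  rcases hsign with hall | hall
  swap
  · intro r hr p hp
    have h := hall (r, p) (mk_mem_prod hr hp)
    simpa only [capTransform, Function.comp_apply] using h
  exfalso
  have h00 : (0 : ℝ) ∈ Ioo (-1 : ℝ) 1 := by norm_num
  have hsub : Icc (-1 : ℝ) 0 ⊆ Ico (-1) 1 := fun t ht => ⟨ht.1, by linarith [ht.2]⟩
  have hunit : ∀ t ∈ Icc (-1 : ℝ) 0, ∀ q ∈ sphSet n, ‖sfun t q‖ = 1 := by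
    intro t ht q hq
    rcases ht.1.eq_or_lt with h | h
    · rw [← h, hinit q hq, norm_neg, e1, PiLp.norm_single, norm_one]
    · exact (hmax t ⟨h, (hsub ht).2⟩ q hq).1
  have hsymm : ∀ q ∈ sphSet n, sfun 0 (-q) = Refl q (sfun 0 q) := by
    intro q hq
    have h2 := hall (0, q) (mk_mem_prod h00 hq)
    have h3 := (hkey 0 h00 q hq).1
    simp only [neg_zero] at h2 h3
    have hq' := mem_sphSet.1 hq
    have hξ' := (hξ 0 h00 _ (neg_mem_sphSet hq)).1
    rw [h2, capTransform_zero hq' (hξ 0 h00 q hq).1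
      (Refl_eq_of_capLin_eq_zero hq' (hξ 0 h00 q hq).1 hξ' h3) (hsS 0 h00 q hq)]
  exact false_of_homotopy_to_Refl_equivariant (hscont.mono (prod_mono hsub subset_rfl)) hunit
    (-(e1 n)) hinit hsymm


end
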